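/- arXiv:math/0002056 — 8 statements merged into one kernel-verified Lean document; each statement's English description precedes it below -/
import Mathlib

section
/- If G is a connected finite simple graph with n ≥ 1 vertices, then 2^(n-1) ≤ C(G) ≤ B(n), where B(n) is the Bell number. -/
/-- A composition of a graph `G` is a partition of its vertex set into (nonempty) blocks,
each of which induces a connected subgraph of `G`.  `numComp G` is the number of
compositions of `G`. -/
noncomputable def numComp {V : Type*} [Fintype V] [DecidableEq V] (G : SimpleGraph V) : ℕ :=
  Nat.card {P : Finpartition (Finset.univ : Finset V) //
    ∀ b ∈ P.parts, (G.induce (b : Set V)).Connected}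

/-- The Bell number `B(n)`: the number of partitions of an `n`-element set into
nonempty subsets. -/
noncomputable def bell (n : ℕ) : ℕ :=
  Nat.card (Finpartition (Finset.univ : Finset (Fin n)))

namespace SimpleGraph

/-- The partition of the vertex set of a graph into its connected components. -/
noncomputable def componentPartition {V : Type*} [Fintype V] [DecidableEq V]
    (H : SimpleGraph V) : Finpartition (Finset.univ : Finset V) :=
  haveI : DecidableRel H.reachableSetoid.r := Classical.decRel _
  Finpartition.ofSetoid H.reachableSetoid

theorem mem_part_componentPartition {V : Type*} [Fintype V] [DecidableEq V]
    (H : SimpleGraph V) {a b : V} :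
    b ∈ H.componentPartition.part a ↔ H.Reachable a b := by
  let : DecidableRel H.reachableSetoid.r := Classical.decRel _
  exact Finpartition.mem_part_ofSetoid_iff_rel

theorem connected_induce_of_mem_componentPartition {V : Type*} [Fintype V] [DecidableEq V]
    (H : SimpleGraph V) {b : Finset V} (hb : b ∈ H.componentPartition.parts) :
    (H.induce (b : Set V)).Connected := by
  obtain ⟨a, ha⟩ := H.componentPartition.nonempty_of_mem_parts hb
  have hsupp : (b : Set V) = (H.connectedComponentMk a).supp := by
    ext x
    rw [Finset.mem_coe, ← H.componentPartition.part_eq_of_mem hb ha,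
      mem_part_componentPartition, ConnectedComponent.mem_supp_iff, ConnectedComponent.eq]
    exact reachable_comm
  rw [hsupp]
  exact (H.connectedComponentMk a).connected_toSimpleGraph

/-- In a forest, the endpoints of an edge are joined using only edges from `S` exactly when
that edge lies in `S`. -/
theorem IsAcyclic.reachable_fromEdgeSet_iff {V : Type*} {T : SimpleGraph V} (hT : T.IsAcyclic)
    {S : Set (Sym2 V)} (hS : S ⊆ T.edgeSet) {u v : V} (huv : T.Adj u v) :
    (fromEdgeSet S).Reachable u v ↔ s(u, v) ∈ S := by
  refine ⟨fun h ↦ ?_, fun h ↦ ((fromEdgeSet_adj S).2 ⟨h, huv.ne⟩).reachable⟩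
  by_contra hmem
  refine isBridge_iff.1 (isAcyclic_iff_forall_adj_isBridge.1 hT huv) (h.mono fun x y hxy ↦ ?_)
  rw [fromEdgeSet_adj] at hxy
  rw [deleteEdges_adj]
  exact ⟨hS hxy.1, fun he ↦ hmem (Set.mem_singleton_iff.1 he ▸ hxy.1)⟩

theorem IsAcyclic.injOn_componentPartition {V : Type*} [Fintype V] [DecidableEq V]
    {T : SimpleGraph V} (hT : T.IsAcyclic) :
    Set.InjOn (fun S ↦ (fromEdgeSet S).componentPartition) (𝒫 T.edgeSet) := by
  intro S hS S' hS' h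
  have key (u v : V) : (fromEdgeSet S).Reachable u v ↔ (fromEdgeSet S').Reachable u v := by
    rw [← mem_part_componentPartition, ← mem_part_componentPartition]
    exact iff_of_eq (congrArg (fun P : Finpartition (Finset.univ : Finset V) ↦ v ∈ P.part u) h)
  have mem_iff {u v : V} (huv : T.Adj u v) : s(u, v) ∈ S ↔ s(u, v) ∈ S' := by
    rw [← hT.reachable_fromEdgeSet_iff hS huv, ← hT.reachable_fromEdgeSet_iff hS' huv, key]
  ext e
  induction e with
  | _ u v => exact ⟨fun he ↦ (mem_iff (hS he)).1 he, fun he ↦ (mem_iff (hS' he)).2 he⟩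

end SimpleGraph

theorem two_pow_card_sub_one_le_numComp {V : Type*} [Fintype V] [DecidableEq V]
    {G : SimpleGraph V} (hG : G.Connected) : 2 ^ (Fintype.card V - 1) ≤ numComp G := by
  classical
  obtain ⟨T, hTG, hT⟩ := hG.exists_isTree_le
  have hcard : 2 ^ (Fintype.card V - 1) = Nat.card (𝒫 T.edgeSet) := by
    rw [← hT.card_edgeFinset, Nat.add_sub_cancel, Nat.card_coe_set_eq, Set.ncard_powerset,
      ← SimpleGraph.coe_edgeFinset, Set.ncard_coe_finset]
  rw [hcard]
  refine Nat.card_le_card_of_injective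
    (fun S : 𝒫 T.edgeSet ↦ ⟨(SimpleGraph.fromEdgeSet S.1).componentPartition, fun b hb ↦ ?_⟩) ?_
  · have hle : SimpleGraph.fromEdgeSet S.1 ≤ G :=
      fun x y hxy ↦ hTG (S.2 ((SimpleGraph.fromEdgeSet_adj _).1 hxy).1)
    exact (SimpleGraph.connected_induce_of_mem_componentPartition _ hb).mono
      (SimpleGraph.comap_monotone _ hle)
  · intro S S' h
    exact Subtype.ext (hT.isAcyclic.injOn_componentPartition S.2 S'.2 (congrArg Subtype.val h))

theorem card_finpartition_univ_le_of_equiv {α β : Type*} [Fintype α] [DecidableEq α]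
    [Fintype β] [DecidableEq β] (e : α ≃ β) :
    Nat.card (Finpartition (Finset.univ : Finset α)) ≤
      Nat.card (Finpartition (Finset.univ : Finset β)) := by
  let f : Finset α ≃o Finset β :=
    { e.finsetCongr with map_rel_iff' := Finset.map_subset_map }
  have hf : f Finset.univ = Finset.univ := Finset.map_univ_equiv e
  refine Nat.card_le_card_of_injective (fun P ↦ (P.map f).copy hf) fun P Q h ↦ ?_
  exact Finpartition.ext (Finset.map_injective _ (congrArg Finpartition.parts h))

theorem numComp_le_bell {V : Type*} [Fintype V] [DecidableEq V] (G : SimpleGraph V) :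
    numComp G ≤ bell (Fintype.card V) :=
  (Nat.card_le_card_of_injective _ Subtype.val_injective).trans
    (card_finpartition_univ_le_of_equiv (Fintype.equivFin V))

/-- For a connected graph `G` on `n ≥ 1` vertices, `2^(n-1) ≤ C(G) ≤ B(n)`. -/
theorem numComp_le_and_ge {V : Type*} [Fintype V] [DecidableEq V] (G : SimpleGraph V)
    (hG : G.Connected) (n : ℕ) (hn : 1 ≤ n) (hcard : Fintype.card V = n) :
    2 ^ (n - 1) ≤ numComp G ∧ numComp G ≤ bell n := by
  subst hcard
  exact ⟨two_pow_card_sub_one_le_numComp hG, numComp_le_bell G⟩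
end

section
/- Let G be a finite simple graph whose vertex set is the union of two sets A and B with A ∩ B = {v} for a single vertex v, such that every edge of G joins two vertices of A or two vertices of B. Then C(G) = C(G[A]) · C(G[B]), where G[A] and G[B] are the subgraphs of G induced on A and B respectively. -/
open Relation in
/-- The classes of `r` induce connected subgraphs of `G`: related vertices are joined by a walk
of `G` that stays within their class. -/
def SimpleGraph.ConnectedClasses {V : Type*} (G : SimpleGraph V) (r : Setoid V) : Prop :=
  ∀ u w, r u w → ReflTransGen (fun a b => G.Adj a b ∧ r a b) u w

/-- The partition into parts of `P`, as an equivalence relation. -/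
def Finpartition.toSetoid {V : Type*} [Fintype V] [DecidableEq V]
    (P : Finpartition (Finset.univ : Finset V)) : Setoid V :=
  Setoid.ker P.part

theorem Finpartition.toSetoid_bijective {V : Type*} [Fintype V] [DecidableEq V] :
    Function.Bijective (Finpartition.toSetoid (V := V)) := by
  classical
  constructor
  · intro P Q h
    have hpart : ∀ a, P.part a = Q.part a := by
      intro a
      ext b
      rw [P.mem_part_iff_part_eq_part (Finset.mem_univ _) (Finset.mem_univ _),
        Q.mem_part_iff_part_eq_part (Finset.mem_univ _) (Finset.mem_univ _)]
      exact Setoid.ext_iff.1 h b a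
    have hparts : ∀ (R : Finpartition (Finset.univ : Finset V)) (b : Finset V),
        b ∈ R.parts ↔ ∃ a, R.part a = b := by
      intro R b
      constructor
      · intro hb
        obtain ⟨a, ha⟩ := R.nonempty_of_mem_parts hb
        exact ⟨a, R.part_eq_of_mem hb ha⟩
      · rintro ⟨a, rfl⟩
        exact R.part_mem.2 (Finset.mem_univ a)
    ext b
    simp only [hparts, hpart]
  · intro s
    refine ⟨Finpartition.ofSetoid s, Setoid.ext fun a b => ?_⟩
    change (Finpartition.ofSetoid s).part a = (Finpartition.ofSetoid s).part b ↔ s a b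
    rw [← Finpartition.mem_part_iff_part_eq_part _ (Finset.mem_univ _) (Finset.mem_univ _),
      Finpartition.mem_part_ofSetoid_iff_rel]
    exact ⟨s.symm, s.symm⟩

theorem Finpartition.forall_parts_connected_iff {V : Type*} [Fintype V] [DecidableEq V]
    (G : SimpleGraph V) (P : Finpartition (Finset.univ : Finset V)) :
    (∀ b ∈ P.parts, (G.induce (b : Set V)).Connected) ↔ G.ConnectedClasses P.toSetoid := by
  have hmem : ∀ {b : Finset V}, b ∈ P.parts → ∀ {x y : V}, x ∈ b → (P.toSetoid x y ↔ y ∈ b) := by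
    intro b hb x y hx
    change P.part x = P.part y ↔ _
    rw [P.part_eq_of_mem hb hx, eq_comm, P.part_eq_iff_mem hb]
  constructor
  · intro h u w huw
    have hb := P.part_mem.2 (Finset.mem_univ u)
    have hu := P.mem_part (Finset.mem_univ u)
    have hreach := (h _ hb).preconnected ⟨u, hu⟩ ⟨w, (hmem hb hu).1 huw⟩
    rw [SimpleGraph.reachable_iff_reflTransGen] at hreach
    exact hreach.lift Subtype.val fun x y hxy => ⟨hxy, (hmem hb x.2).2 y.2⟩
  · intro h b hb
    obtain ⟨a, ha⟩ := P.nonempty_of_mem_parts hb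
    have : Nonempty (b : Set V) := ⟨⟨a, ha⟩⟩
    refine SimpleGraph.Connected.mk fun x y => ?_
    have hwalk : ∀ z, Relation.ReflTransGen (fun a b => G.Adj a b ∧ P.toSetoid a b) x z →
        ∃ hz : z ∈ b, (G.induce (b : Set V)).Reachable x ⟨z, hz⟩ := by
      intro z hz
      induction hz with
      | refl => exact ⟨x.2, .refl _⟩
      | tail _ hstep ih =>
        obtain ⟨hc, hreach⟩ := ih
        refine ⟨(hmem hb hc).1 hstep.2, hreach.trans (SimpleGraph.Adj.reachable ?_)⟩
        exact hstep.1
    exact (hwalk y (h x y ((hmem hb x.2).2 y.2))).2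

theorem numComp_eq_card_connectedClasses {V : Type*} [Fintype V] [DecidableEq V]
    (G : SimpleGraph V) : numComp G = Nat.card {r : Setoid V // G.ConnectedClasses r} :=
  Nat.card_congr ((Equiv.ofBijective _ Finpartition.toSetoid_bijective).subtypeEquiv
    fun P => Finpartition.forall_parts_connected_iff G P)

open Classical in
/-- The map onto `A` that collapses the complement of `A` to the vertex `v` of `A`. -/
noncomputable def Set.collapse {V : Type*} (A : Set V) (v : A) (u : V) : A :=
  if h : u ∈ A then ⟨u, h⟩ else v

theorem Set.collapse_coe {V : Type*} (A : Set V) (v u : A) : A.collapse v u = u := by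
  simp [Set.collapse]

theorem Set.collapse_of_mem {V : Type*} {A : Set V} (v : A) {u : V} (h : u ∈ A) :
    A.collapse v u = ⟨u, h⟩ := by
  simp [Set.collapse, h]

theorem Set.collapse_of_mem_right {V : Type*} {A B : Set V} {v : V} (hA : v ∈ A)
    (hinter : ∀ u ∈ A, u ∈ B → u = v) {u : V} (h : u ∈ B) : A.collapse ⟨v, hA⟩ u = ⟨v, hA⟩ := by
  unfold Set.collapse
  split_ifs with hu
  · exact Subtype.ext (hinter u hu h)
  · rfl

namespace SimpleGraph.ConnectedClasses

variable {V : Type*} {G : SimpleGraph V} {A B : Set V} {v : V} {r : Setoid V}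

theorem reflTransGen_collapse (hA : v ∈ A) (hinter : ∀ u ∈ A, u ∈ B → u = v)
    (hedge : ∀ u w, G.Adj u w → (u ∈ A ∧ w ∈ A) ∨ (u ∈ B ∧ w ∈ B))
    (hr : G.ConnectedClasses r) {u w : V} (huw : r u w) :
    Relation.ReflTransGen
      (fun a b => (G.induce A).Adj a b ∧ Setoid.comap Subtype.val r a b)
      (A.collapse ⟨v, hA⟩ u) (A.collapse ⟨v, hA⟩ w) := by
  refine (hr u w huw).lift' _ fun a b hab => ?_
  rcases hedge a b hab.1 with ⟨ha, hb⟩ | ⟨ha, hb⟩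
  · refine .single ?_
    rw [Set.collapse_of_mem _ ha, Set.collapse_of_mem _ hb]
    exact hab
  · change Relation.ReflTransGen _ (A.collapse _ a) (A.collapse _ b)
    rw [Set.collapse_of_mem_right hA hinter ha, Set.collapse_of_mem_right hA hinter hb]

theorem comap_coe (hA : v ∈ A) (hinter : ∀ u ∈ A, u ∈ B → u = v)
    (hedge : ∀ u w, G.Adj u w → (u ∈ A ∧ w ∈ A) ∨ (u ∈ B ∧ w ∈ B))
    (hr : G.ConnectedClasses r) : (G.induce A).ConnectedClasses (r.comap Subtype.val) := by
  intro u w huw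
  simpa only [Set.collapse_coe] using hr.reflTransGen_collapse hA hinter hedge huw

theorem rel_collapse (hA : v ∈ A) (hinter : ∀ u ∈ A, u ∈ B → u = v)
    (hedge : ∀ u w, G.Adj u w → (u ∈ A ∧ w ∈ A) ∨ (u ∈ B ∧ w ∈ B))
    (hr : G.ConnectedClasses r) {u w : V} (huw : r u w) :
    r (A.collapse ⟨v, hA⟩ u) (A.collapse ⟨v, hA⟩ w) := by
  have h := hr.reflTransGen_collapse hA hinter hedge huw
  generalize A.collapse ⟨v, hA⟩ w = y at h
  induction h with
  | refl => exact r.refl _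
  | tail _ hstep ih => exact r.trans ih hstep.2

end SimpleGraph.ConnectedClasses

/-- The equivalence relation on `V` obtained by gluing relations on `A` and `B` at a common
vertex. -/
noncomputable def Setoid.glue {V : Type*} {A B : Set V} (a : A) (b : B) (s : Setoid A)
    (t : Setoid B) : Setoid V :=
  s.comap (A.collapse a) ⊓ t.comap (B.collapse b)

section Glue

variable {V : Type*} {G : SimpleGraph V} {A B : Set V} {v : V}

theorem Setoid.glue_swap (a : A) (b : B) (s : Setoid A) (t : Setoid B) :
    Setoid.glue b a t s = Setoid.glue a b s t :=
  inf_comm _ _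

theorem Setoid.comap_coe_glue (hA : v ∈ A) (hB : v ∈ B) (hinter : ∀ u ∈ A, u ∈ B → u = v)
    (s : Setoid A) (t : Setoid B) :
    (Setoid.glue ⟨v, hA⟩ ⟨v, hB⟩ s t).comap Subtype.val = s := by
  ext u w
  change s (A.collapse _ u) (A.collapse _ w) ∧ t (B.collapse _ u) (B.collapse _ w) ↔ s u w
  have hinter' : ∀ x ∈ B, x ∈ A → x = v := fun x hx hx' => hinter x hx' hx
  rw [Set.collapse_coe, Set.collapse_coe, Set.collapse_of_mem_right hB hinter' u.2,
    Set.collapse_of_mem_right hB hinter' w.2]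
  exact and_iff_left (t.refl _)

theorem Setoid.glue_comap_coe (hA : v ∈ A) (hB : v ∈ B) (hunion : ∀ u, u ∈ A ∨ u ∈ B)
    (hinter : ∀ u ∈ A, u ∈ B → u = v)
    (hedge : ∀ u w, G.Adj u w → (u ∈ A ∧ w ∈ A) ∨ (u ∈ B ∧ w ∈ B))
    {r : Setoid V} (hr : G.ConnectedClasses r) :
    Setoid.glue (⟨v, hA⟩ : A) (⟨v, hB⟩ : B) (r.comap Subtype.val) (r.comap Subtype.val) = r := by
  have hinter' : ∀ x ∈ B, x ∈ A → x = v := fun x hx hx' => hinter x hx' hx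
  have hedge' := fun u w h => (hedge u w h).symm
  ext u w
  change r (A.collapse _ u) (A.collapse _ w) ∧ r (B.collapse _ u) (B.collapse _ w) ↔ r u w
  refine ⟨?_, fun h => ⟨hr.rel_collapse hA hinter hedge h, hr.rel_collapse hB hinter' hedge' h⟩⟩
  rintro ⟨h₁, h₂⟩
  rcases hunion u with hu | hu <;> rcases hunion w with hw | hw
  · rwa [Set.collapse_of_mem _ hu, Set.collapse_of_mem _ hw] at h₁
  · rw [Set.collapse_of_mem _ hu, Set.collapse_of_mem_right hA hinter hw] at h₁
    rw [Set.collapse_of_mem _ hw, Set.collapse_of_mem_right hB hinter' hu] at h₂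
    exact r.trans h₁ h₂
  · rw [Set.collapse_of_mem _ hw, Set.collapse_of_mem_right hA hinter hu] at h₁
    rw [Set.collapse_of_mem _ hu, Set.collapse_of_mem_right hB hinter' hw] at h₂
    exact r.trans h₂ h₁
  · rwa [Set.collapse_of_mem _ hu, Set.collapse_of_mem _ hw] at h₂

theorem SimpleGraph.ConnectedClasses.reflTransGen_glue (hA : v ∈ A) (hB : v ∈ B)
    (hinter : ∀ u ∈ A, u ∈ B → u = v) {s : Setoid A} {t : Setoid B}
    (hs : (G.induce A).ConnectedClasses s) {u w : A} (huw : s u w) :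
    Relation.ReflTransGen
      (fun a b => G.Adj a b ∧ Setoid.glue ⟨v, hA⟩ ⟨v, hB⟩ s t a b) (u : V) w := by
  refine (hs u w huw).lift Subtype.val fun a b hab => ⟨hab.1, ?_⟩
  have h := hab.2
  rwa [← Setoid.comap_coe_glue hA hB hinter s t] at h

theorem SimpleGraph.ConnectedClasses.glue (hA : v ∈ A) (hB : v ∈ B)
    (hunion : ∀ u, u ∈ A ∨ u ∈ B) (hinter : ∀ u ∈ A, u ∈ B → u = v)
    {s : Setoid A} {t : Setoid B}
    (hs : (G.induce A).ConnectedClasses s) (ht : (G.induce B).ConnectedClasses t) :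
    G.ConnectedClasses (Setoid.glue ⟨v, hA⟩ ⟨v, hB⟩ s t) := by
  have hinter' : ∀ x ∈ B, x ∈ A → x = v := fun x hx hx' => hinter x hx' hx
  rintro u w ⟨h₁, h₂⟩
  replace h₁ := hs.reflTransGen_glue (t := t) hA hB hinter h₁
  replace h₂ := ht.reflTransGen_glue (t := s) hB hA hinter' h₂
  rw [Setoid.glue_swap] at h₂
  rcases hunion u with hu | hu <;> rcases hunion w with hw | hw
  · rwa [Set.collapse_of_mem _ hu, Set.collapse_of_mem _ hw] at h₁
  · rw [Set.collapse_of_mem _ hu, Set.collapse_of_mem_right hA hinter hw] at h₁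
    rw [Set.collapse_of_mem _ hw, Set.collapse_of_mem_right hB hinter' hu] at h₂
    exact h₁.trans h₂
  · rw [Set.collapse_of_mem _ hw, Set.collapse_of_mem_right hA hinter hu] at h₁
    rw [Set.collapse_of_mem _ hu, Set.collapse_of_mem_right hB hinter' hw] at h₂
    exact h₂.trans h₁
  · rwa [Set.collapse_of_mem _ hu, Set.collapse_of_mem _ hw] at h₂

/-- Relations with connected classes on a graph glued from `A` and `B` at one vertex are pairs of
such relations on `A` and on `B`. -/
noncomputable def SimpleGraph.connectedClassesEquivProd (hA : v ∈ A) (hB : v ∈ B)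
    (hunion : ∀ u, u ∈ A ∨ u ∈ B) (hinter : ∀ u ∈ A, u ∈ B → u = v)
    (hedge : ∀ u w, G.Adj u w → (u ∈ A ∧ w ∈ A) ∨ (u ∈ B ∧ w ∈ B)) :
    {r : Setoid V // G.ConnectedClasses r} ≃
      {s : Setoid A // (G.induce A).ConnectedClasses s} ×
        {t : Setoid B // (G.induce B).ConnectedClasses t} where
  toFun r := (⟨_, r.2.comap_coe hA hinter hedge⟩,
    ⟨_, r.2.comap_coe hB (fun x hx hx' => hinter x hx' hx) fun u w h => (hedge u w h).symm⟩)
  invFun p := ⟨_, p.1.2.glue hA hB hunion hinter p.2.2⟩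
  left_inv r := Subtype.ext (Setoid.glue_comap_coe hA hB hunion hinter hedge r.2)
  right_inv p := by
    refine Prod.ext (Subtype.ext (Setoid.comap_coe_glue hA hB hinter _ _)) (Subtype.ext ?_)
    change (Setoid.glue _ _ _ _).comap Subtype.val = _
    rw [← Setoid.glue_swap]
    exact Setoid.comap_coe_glue hB hA (fun x hx hx' => hinter x hx' hx) _ _

end Glue

/-- If the vertex set of `G` is the union of `A` and `B` with `A ∩ B = {v}` a single
vertex, and every edge of `G` lies within `A` or within `B`, then
`C(G) = C(G[A]) · C(G[B])`. -/
theorem numComp_one_common_vertex {V : Type*} [Fintype V] [DecidableEq V] (G : SimpleGraph V)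
    (A B : Finset V) (hunion : A ∪ B = Finset.univ) (v : V) (hinter : A ∩ B = {v})
    (hedge : ∀ u w : V, G.Adj u w → (u ∈ A ∧ w ∈ A) ∨ (u ∈ B ∧ w ∈ B)) :
    numComp G = numComp (G.induce (A : Set V)) * numComp (G.induce (B : Set V)) := by
  have hmem : ∀ u, u ∈ A ∧ u ∈ B ↔ u = v := by
    simpa [Finset.ext_iff] using hinter
  have hcover : ∀ u, u ∈ A ∨ u ∈ B := by
    simpa [Finset.ext_iff] using hunion
  obtain ⟨hA, hB⟩ := (hmem v).2 rfl
  rw [numComp_eq_card_connectedClasses, numComp_eq_card_connectedClasses,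
    numComp_eq_card_connectedClasses, ← Nat.card_prod]
  exact Nat.card_congr (SimpleGraph.connectedClassesEquivProd (A := (A : Set V))
    (B := (B : Set V)) hA hB hcover (fun u hu hu' => (hmem u).1 ⟨hu, hu'⟩) hedge)
end

section
/- Let G be a finite simple graph whose vertex set is partitioned into two sets A and B, such that there is exactly one edge e of G joining a vertex of A to a vertex of B (all other edges of G lie within A or within B). Then C(G) = 2 · C(G[A]) · C(G[B]), where G[A] and G[B] are the subgraphs of G induced on A and B respectively. -/
open Relation

/-- A setoid on the vertices of `G` is a composition when any two equivalent vertices are joined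
by a walk of `G` all of whose steps stay inside the equivalence class. -/
def Setoid.IsComposition {V : Type*} (G : SimpleGraph V) (r : Setoid V) : Prop :=
  ∀ x y, r x y → ReflTransGen (fun u v => G.Adj u v ∧ r u v) x y

/-- The setoid whose classes are the connected components of a symmetric relation. -/
def Relation.reflTransGenSetoid {V : Type*} (H : V → V → Prop) (hH : ∀ x y, H x y → H y x) :
    Setoid V where
  r := ReflTransGen H
  iseqv := ⟨fun _ => .refl, fun h => ReflTransGen.mono (fun x y => hH y x) _ _ (reflTransGen_swap.2 h),
    fun h h' => h.trans h'⟩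

theorem Setoid.isComposition_reflTransGenSetoid {V : Type*} (G : SimpleGraph V)
    (H : V → V → Prop) (hH : ∀ x y, H x y → H y x) (hG : ∀ x y, H x y → G.Adj x y) :
    (reflTransGenSetoid H hH).IsComposition G :=
  fun _ _ h => ReflTransGen.mono (fun u v huv => ⟨hG u v huv, ReflTransGen.single huv⟩) _ _ h

theorem Setoid.rel_of_reflTransGen {V : Type*} (r : Setoid V) {H : V → V → Prop}
    (hH : ∀ u v, H u v → r u v) {x y : V} (h : ReflTransGen H x y) : r x y := by
  induction h with
  | refl => exact r.refl _
  | tail _ h ih => exact r.trans ih (hH _ _ h)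

/-- If `H` leaves and enters `S` only at `a`, an `H`-walk starting in `S` can be shortened to
a walk inside `S`, ending at `a` if the original walk ends outside `S`. -/
theorem Relation.ReflTransGen.exists_induce {V : Type*} {H : V → V → Prop} {S : Set V} {a : V}
    (ha : a ∈ S) (hout : ∀ u ∈ S, ∀ v ∉ S, H u v → u = a)
    (hin : ∀ u ∉ S, ∀ v ∈ S, H u v → v = a) (x : S) {y : V} (h : ReflTransGen H x y) :
    (∀ hy : y ∈ S, ReflTransGen (fun u v : S => H u v) x ⟨y, hy⟩) ∧
      (y ∉ S → ReflTransGen (fun u v : S => H u v) x ⟨a, ha⟩) := by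
  induction h with
  | refl => exact ⟨fun _ => .refl, fun h => absurd x.2 h⟩
  | @tail u v _ huv ih =>
    by_cases hu : u ∈ S
    · refine ⟨fun hv => (ih.1 hu).tail huv, fun hv => ?_⟩
      obtain rfl := hout u hu v hv huv
      exact ih.1 hu
    · refine ⟨fun hv => ?_, fun _ => ih.2 hu⟩
      obtain rfl := hin u hu v hv huv
      exact ih.2 hu

theorem SimpleGraph.connected_induce_part_iff {V : Type*} [Fintype V] [DecidableEq V]
    (G : SimpleGraph V) (P : Finpartition (Finset.univ : Finset V)) :
    (∀ b ∈ P.parts, (G.induce (b : Set V)).Connected) ↔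
      (Setoid.ker P.part).IsComposition G := by
  constructor
  · intro h x y hxy
    have hx : x ∈ P.part x := P.mem_part (Finset.mem_univ x)
    have hy : y ∈ P.part x := by
      rw [show P.part x = P.part y from hxy]
      exact P.mem_part (Finset.mem_univ y)
    have hp := P.part_mem.2 (Finset.mem_univ x)
    have hr := (h _ hp).preconnected ⟨x, hx⟩ ⟨y, hy⟩
    rw [SimpleGraph.reachable_iff_reflTransGen] at hr
    refine hr.lift Subtype.val fun u v huv => ⟨huv, ?_⟩
    exact (P.part_eq_of_mem hp u.2).trans (P.part_eq_of_mem hp v.2).symm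
  · intro h b hb
    obtain ⟨x, hx⟩ := P.nonempty_of_mem_parts hb
    rw [SimpleGraph.connected_iff_exists_forall_reachable]
    refine ⟨⟨x, hx⟩, fun ⟨y, hy⟩ => ?_⟩
    have hw := h x y ((P.part_eq_of_mem hb hx).trans (P.part_eq_of_mem hb hy).symm)
    have key : ∃ hy : y ∈ b, (G.induce (b : Set V)).Reachable ⟨x, hx⟩ ⟨y, hy⟩ := by
      clear hy
      induction hw with
      | refl => exact ⟨hx, .rfl⟩
      | @tail u v _ huv ih =>
        obtain ⟨hu, hxu⟩ := ih
        have hv : v ∈ b := by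
          rw [← P.part_eq_of_mem hb hu, show P.part u = P.part v from huv.2]
          exact P.mem_part (Finset.mem_univ v)
        refine ⟨hv, hxu.trans (SimpleGraph.Adj.reachable ?_)⟩
        exact huv.1
    exact key.2

theorem Finpartition.ker_part_bijective {V : Type*} [Fintype V] [DecidableEq V] :
    Function.Bijective
      fun P : Finpartition (Finset.univ : Finset V) => Setoid.ker P.part := by
  classical
  constructor
  · have key : ∀ P Q : Finpartition (Finset.univ : Finset V),
        Setoid.ker P.part = Setoid.ker Q.part → P.parts ⊆ Q.parts := by
      intro P Q h b hb
      obtain ⟨x, hx⟩ := P.nonempty_of_mem_parts hb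
      have hbQ : b = Q.part x := by
        rw [← P.part_eq_of_mem hb hx]
        ext y
        rw [P.mem_part_iff_part_eq_part (Finset.mem_univ _) (Finset.mem_univ _),
          Q.mem_part_iff_part_eq_part (Finset.mem_univ _) (Finset.mem_univ _)]
        exact Setoid.ext_iff.1 h y x
      rw [hbQ]
      exact Q.part_mem.2 (Finset.mem_univ x)
    exact fun P Q h => Finpartition.ext ((key P Q h).antisymm (key Q P h.symm))
  · intro r
    refine ⟨Finpartition.ofSetoid r, Setoid.ext fun x y => ?_⟩
    change (Finpartition.ofSetoid r).part x = (Finpartition.ofSetoid r).part y ↔ r x y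
    rw [← Finpartition.mem_part_ofSetoid_iff_rel,
      Finpartition.mem_part_iff_part_eq_part _ (Finset.mem_univ _) (Finset.mem_univ _)]
    exact eq_comm

theorem numComp_eq_card_setoid {V : Type*} [Fintype V] [DecidableEq V] (G : SimpleGraph V) :
    numComp G = Nat.card {r : Setoid V // r.IsComposition G} :=
  Nat.card_congr ((Equiv.ofBijective _ Finpartition.ker_part_bijective).subtypeEquiv
    G.connected_induce_part_iff)

section Bridge

variable {V : Type*} {G : SimpleGraph V} {S : Set V} {a b : V}

theorem Setoid.IsComposition.exists_induce {r : Setoid V} (hr : r.IsComposition G)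
    (ha : a ∈ S) (huniq : ∀ u ∈ S, ∀ w ∉ S, G.Adj u w → u = a) {x y : V} (hx : x ∈ S)
    (hxy : r x y) :
    (∀ hy : y ∈ S, ReflTransGen (fun u v : S => G.Adj u v ∧ r u v) ⟨x, hx⟩ ⟨y, hy⟩) ∧
      (y ∉ S → r x a) := by
  have h := ReflTransGen.exists_induce ha (fun u hu v hv h => huniq u hu v hv h.1)
    (fun u hu v hv h => huniq v hv u hu h.1.symm) ⟨x, hx⟩ (hr x y hxy)
  exact ⟨h.1, fun hy => (r.comap Subtype.val).rel_of_reflTransGen (fun _ _ h => h.2) (h.2 hy)⟩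

theorem Setoid.IsComposition.comap_subtype {r : Setoid V} (hr : r.IsComposition G)
    (ha : a ∈ S) (huniq : ∀ u ∈ S, ∀ w ∉ S, G.Adj u w → u = a) :
    (r.comap (Subtype.val : S → V)).IsComposition (G.induce S) :=
  fun x y hxy => (hr.exists_induce ha huniq x.2 hxy).1 y.2

/-- A composition of `G` amounts to a composition of each side of the bridge `ab`, together with
the choice of whether `a` and `b` are equivalent. -/
theorem SimpleGraph.card_isComposition_bridge (ha : a ∈ S) (hb : b ∉ S) (hab : G.Adj a b)
    (huniq : ∀ u ∈ S, ∀ w ∉ S, G.Adj u w → u = a ∧ w = b) :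
    Nat.card {r : Setoid V // r.IsComposition G} =
      2 * Nat.card {r : Setoid S // r.IsComposition (G.induce S)} *
        Nat.card {r : Setoid ↥Sᶜ // r.IsComposition (G.induce Sᶜ)} := by
  have hA : ∀ u ∈ S, ∀ w ∉ S, G.Adj u w → u = a := fun u hu w hw h => (huniq u hu w hw h).1
  have hB : ∀ u ∈ Sᶜ, ∀ w ∉ Sᶜ, G.Adj u w → u = b := fun u hu w hw h =>
    (huniq w (not_not.1 hw) u hu h.symm).2
  let f : {r : Setoid V // r.IsComposition G} →
      Prop × {r : Setoid S // r.IsComposition (G.induce S)} ×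
        {r : Setoid ↥Sᶜ // r.IsComposition (G.induce Sᶜ)} := fun r =>
    (r.1 a b, ⟨_, r.2.comap_subtype ha hA⟩, ⟨_, r.2.comap_subtype hb hB⟩)
  have hf : Function.Bijective f := by
    constructor
    · have key : ∀ r r' : {r : Setoid V // r.IsComposition G}, f r = f r' →
          ∀ x y, r.1 x y → r'.1 x y := by
        intro r r' h
        obtain ⟨h0, h12⟩ := Prod.mk.inj h
        obtain ⟨h1, h2⟩ := Prod.mk.inj h12
        have hS : ∀ x ∈ S, ∀ y ∈ S, r.1 x y → r'.1 x y := fun x hx y hy =>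
          (Setoid.ext_iff.1 (Subtype.ext_iff.1 h1) ⟨x, hx⟩ ⟨y, hy⟩).1
        have hT : ∀ x ∉ S, ∀ y ∉ S, r.1 x y → r'.1 x y := fun x hx y hy =>
          (Setoid.ext_iff.1 (Subtype.ext_iff.1 h2) ⟨x, hx⟩ ⟨y, hy⟩).1
        have hST : ∀ x ∈ S, ∀ y ∉ S, r.1 x y → r'.1 x y := by
          intro x hx y hy hxy
          have hxa := (r.2.exists_induce ha hA hx hxy).2 hy
          have hyb := (r.2.exists_induce hb hB hy (r.1.symm hxy)).2 (not_not.2 hx)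
          have hab : r.1 a b := r.1.trans (r.1.symm hxa) (r.1.trans hxy hyb)
          exact r'.1.trans (hS _ hx _ ha hxa)
            (r'.1.trans (h0.mp hab) (r'.1.symm (hT _ hy _ hb hyb)))
        intro x y hxy
        by_cases hx : x ∈ S <;> by_cases hy : y ∈ S
        · exact hS x hx y hy hxy
        · exact hST x hx y hy hxy
        · exact r'.1.symm (hST y hy x hx (r.1.symm hxy))
        · exact hT x hx y hy hxy
      exact fun r r' h => Subtype.ext <| Setoid.ext fun x y =>
        ⟨key r r' h x y, key r' r h.symm x y⟩
    · rintro ⟨ε, ⟨s, hs⟩, ⟨t, ht⟩⟩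
      let H : V → V → Prop := fun x y => G.Adj x y ∧
        (∀ (hx : x ∈ S) (hy : y ∈ S), s ⟨x, hx⟩ ⟨y, hy⟩) ∧
        (∀ (hx : x ∈ Sᶜ) (hy : y ∈ Sᶜ), t ⟨x, hx⟩ ⟨y, hy⟩) ∧
        (x ∈ S → y ∉ S → ε) ∧ (y ∈ S → x ∉ S → ε)
      have hH : ∀ x y, H x y → H y x := fun x y h =>
        ⟨h.1.symm, fun hy hx => s.symm (h.2.1 hx hy), fun hy hx => t.symm (h.2.2.1 hx hy),
          h.2.2.2.2, h.2.2.2.1⟩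
      refine ⟨⟨_, Setoid.isComposition_reflTransGenSetoid G H hH fun _ _ h => h.1⟩, ?_⟩
      refine Prod.ext (propext ⟨fun h => ?_, fun h => ?_⟩)
        (Prod.ext (Subtype.ext (Setoid.ext fun x y => ⟨fun h => ?_, fun h => ?_⟩))
          (Subtype.ext (Setoid.ext fun x y => ⟨fun h => ?_, fun h => ?_⟩)))
      · change ReflTransGen H a b at h
        by_contra hε
        have hstay : ∀ y, ReflTransGen H a y → y ∈ S := by
          intro y hy
          induction hy with
          | refl => exact ha
          | tail _ h ih => exact by_contra fun hv => hε (h.2.2.2.1 ih hv)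
        exact hb (hstay b h)
      · change ReflTransGen H a b
        exact ReflTransGen.single ⟨hab, fun _ hb' => absurd hb' hb, fun ha' => absurd ha ha',
          fun _ _ => h, fun _ _ => h⟩
      · change ReflTransGen H x y at h
        exact s.rel_of_reflTransGen (fun u v h => h.2.1 u.2 v.2)
          ((ReflTransGen.exists_induce ha (fun u hu v hv h => hA u hu v hv h.1)
            (fun u hu v hv h => hA v hv u hu h.1.symm) x h).1 y.2)
      · change ReflTransGen H x y
        exact (hs x y h).lift Subtype.val fun u v h => ⟨h.1, fun _ _ => h.2,
          fun hu => absurd u.2 hu, fun _ hv => absurd v.2 hv, fun _ hu => absurd u.2 hu⟩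
      · change ReflTransGen H x y at h
        exact t.rel_of_reflTransGen (fun u v h => h.2.2.1 u.2 v.2)
          ((ReflTransGen.exists_induce (S := Sᶜ) hb (fun u hu v hv h => hB u hu v hv h.1)
            (fun u hu v hv h => hB v hv u hu h.1.symm) x h).1 y.2)
      · change ReflTransGen H x y
        exact (ht x y h).lift Subtype.val fun u v h => ⟨h.1, fun hu => absurd hu u.2,
          fun _ _ => h.2, fun hu => absurd hu u.2, fun hv => absurd hv v.2⟩
  rw [Nat.card_congr (Equiv.ofBijective f hf), Nat.card_prod, Nat.card_prod, mul_assoc]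
  simp

end Bridge

/-- If the vertex set of `G` is partitioned into `A` and `B`, and there is exactly one
edge of `G` joining a vertex of `A` to a vertex of `B`, then
`C(G) = 2 · C(G[A]) · C(G[B])`. -/
theorem numComp_bridge {V : Type*} [Fintype V] [DecidableEq V] (G : SimpleGraph V)
    (A B : Finset V) (hdisj : Disjoint A B) (hunion : A ∪ B = Finset.univ)
    (a b : V) (ha : a ∈ A) (hb : b ∈ B) (hab : G.Adj a b)
    (huniq : ∀ u ∈ A, ∀ w ∈ B, G.Adj u w → u = a ∧ w = b) :
    numComp G = 2 * numComp (G.induce (A : Set V)) * numComp (G.induce (B : Set V)) := by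
  have hmem : ∀ w, w ∉ A ↔ w ∈ B := fun w =>
    ⟨(Finset.mem_union.1 (hunion ▸ Finset.mem_univ w)).resolve_left,
      fun hw hA => Finset.disjoint_left.1 hdisj hA hw⟩
  have hB : (B : Set V) = (A : Set V)ᶜ := Set.ext fun w => (hmem w).symm
  rw [numComp_eq_card_setoid, numComp_eq_card_setoid, numComp_eq_card_setoid, hB]
  exact SimpleGraph.card_isComposition_bridge ha ((hmem b).2 hb) hab
    fun u hu w hw => huniq u hu w ((hmem w).1 hw)
end

section
/- For n ≥ 2, let K_n⁻ denote the graph obtained from the complete graph K_n on n vertices by deleting a single edge. Then C(K_n⁻) = B(n) − B(n−2), where B denotes the Bell numbers (with B(0) = 1). -/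
/-- Transport of a finite partition along an embedding. -/
def Finpartition.mapEmbedding {α β : Type*} [DecidableEq α] [DecidableEq β] (f : α ↪ β)
    {s : Finset α} (P : Finpartition s) : Finpartition (s.map f) :=
  Finpartition.ofExistsUnique (P.parts.map (Finset.mapEmbedding f).toEmbedding)
    (by
      intro p hp
      obtain ⟨q, hq, rfl⟩ := Finset.mem_map.1 hp
      exact Finset.map_subset_map.2 (P.le hq))
    (by
      intro b hb
      obtain ⟨a, ha, rfl⟩ := Finset.mem_map.1 hb
      obtain ⟨t, ⟨ht, hat⟩, htu⟩ := P.existsUnique_mem ha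
      refine ⟨t.map f, ⟨Finset.mem_map_of_mem _ ht, Finset.mem_map_of_mem _ hat⟩, ?_⟩
      rintro q ⟨hq, haq⟩
      obtain ⟨r, hr, rfl⟩ := Finset.mem_map.1 hq
      have har : a ∈ r := (Finset.mem_map' f).1 haq
      rw [htu r ⟨hr, har⟩]
      rfl)
    (by
      intro h
      obtain ⟨q, hq, h0⟩ := Finset.mem_map.1 h
      exact P.ne_empty hq (Finset.map_eq_empty.1 h0))

theorem Finpartition.mapEmbedding_bijective {α β : Type*} [DecidableEq α] [DecidableEq β]
    (f : α ↪ β) (s : Finset α) :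
    Function.Bijective (Finpartition.mapEmbedding f : Finpartition s → _) := by
  constructor
  · intro P Q h
    exact Finpartition.ext (Finset.map_injective _ (congrArg Finpartition.parts h))
  · intro Q
    have hQ : ∀ q ∈ Q.parts, (q.preimage f f.injective.injOn).map f = q := by
      intro q hq
      ext b
      simp only [Finset.mem_map, Finset.mem_preimage]
      constructor
      · rintro ⟨a, ha, rfl⟩
        exact ha
      · intro hb
        obtain ⟨a, -, rfl⟩ := Finset.mem_map.1 (Q.le hq hb)
        exact ⟨a, hb, rfl⟩
    refine ⟨Finpartition.ofExistsUnique
      (Q.parts.image fun q ↦ q.preimage f f.injective.injOn) ?_ ?_ ?_, ?_⟩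
    · intro p hp
      obtain ⟨q, hq, rfl⟩ := Finset.mem_image.1 hp
      rw [← Finset.map_subset_map (f := f), hQ q hq]
      exact Q.le hq
    · intro a ha
      obtain ⟨t, ⟨ht, hat⟩, htu⟩ := Q.existsUnique_mem (Finset.mem_map_of_mem f ha)
      refine ⟨t.preimage f f.injective.injOn,
        ⟨Finset.mem_image_of_mem _ ht, Finset.mem_preimage.2 hat⟩, ?_⟩
      rintro p ⟨hp, hap⟩
      obtain ⟨q, hq, rfl⟩ := Finset.mem_image.1 hp
      rw [htu q ⟨hq, Finset.mem_preimage.1 hap⟩]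
    · intro h
      obtain ⟨q, hq, h0⟩ := Finset.mem_image.1 h
      have := hQ q hq
      rw [h0, Finset.map_empty] at this
      exact Q.ne_empty hq this.symm
    · apply Finpartition.ext
      ext b
      simp only [mapEmbedding, ofExistsUnique, Finset.mem_map, Finset.mem_image,
        exists_exists_and_eq_and]
      constructor
      · rintro ⟨q, hq, rfl⟩
        change (q.preimage f f.injective.injOn).map f ∈ Q.parts
        rwa [hQ q hq]
      · intro hb
        exact ⟨b, hb, hQ b hb⟩

theorem card_finpartition_eq_bell {α : Type*} [DecidableEq α] (s : Finset α) :
    Nat.card (Finpartition s) = bell s.card := by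
  let f : Fin s.card ↪ α := s.equivFin.symm.toEmbedding.trans (Function.Embedding.subtype _)
  have hs : Finset.univ.map f = s := by
    ext a
    simp only [Finset.mem_map, Finset.mem_univ, true_and]
    constructor
    · rintro ⟨i, rfl⟩
      exact (s.equivFin.symm i).2
    · intro ha
      exact ⟨s.equivFin ⟨a, ha⟩, by simp [f]⟩
  have h := Nat.card_eq_of_bijective _ (Finpartition.mapEmbedding_bijective f Finset.univ)
  rw [hs] at h
  exact h.symm

/-- The partitions of `s` having `b` as a block correspond to the partitions of `s \ b`. -/
theorem card_finpartition_mem_parts {α : Type*} [DecidableEq α] {s b : Finset α}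
    (hb : b.Nonempty) (hbs : b ⊆ s) :
    Nat.card {P : Finpartition s // b ∈ P.parts} = Nat.card (Finpartition (s \ b)) := by
  symm
  let F : Finpartition (s \ b) → {P : Finpartition s // b ∈ P.parts} := fun P ↦
    ⟨P.extend hb.ne_empty Finset.sdiff_disjoint (Finset.sdiff_union_of_subset hbs),
      Finset.mem_insert_self _ _⟩
  have hnot : ∀ P : Finpartition (s \ b), b ∉ P.parts := by
    intro P h
    obtain ⟨x, hx⟩ := hb
    exact (Finset.mem_sdiff.1 (P.le h hx)).2 hx
  refine Nat.card_eq_of_bijective F ⟨?_, ?_⟩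
  · intro P Q h
    have h' : insert b P.parts = insert b Q.parts :=
      congrArg (fun R : {P : Finpartition s // b ∈ P.parts} ↦ R.1.parts) h
    apply Finpartition.ext
    rw [← Finset.erase_insert (hnot P), h', Finset.erase_insert (hnot Q)]
  · rintro ⟨Q, hQ⟩
    refine ⟨Finpartition.ofExistsUnique (Q.parts.erase b) ?_ ?_ ?_, ?_⟩
    · intro p hp x hx
      obtain ⟨hpb, hp⟩ := Finset.mem_erase.1 hp
      exact Finset.mem_sdiff.2 ⟨Q.le hp hx, fun hxb ↦ hpb (Q.eq_of_mem_parts hp hQ hx hxb)⟩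
    · intro a ha
      obtain ⟨has, hab⟩ := Finset.mem_sdiff.1 ha
      obtain ⟨t, ⟨ht, hat⟩, htu⟩ := Q.existsUnique_mem has
      exact ⟨t, ⟨Finset.mem_erase.2 ⟨fun h ↦ hab (h ▸ hat), ht⟩, hat⟩,
        fun q hq ↦ htu q ⟨Finset.mem_of_mem_erase hq.1, hq.2⟩⟩
    · exact fun h ↦ Q.ne_empty (Finset.mem_of_mem_erase h) rfl
    · exact Subtype.ext (Finpartition.ext (Finset.insert_erase hQ))

/-- In a complete graph minus the edge `uv`, the only nonempty vertex set inducing a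
disconnected subgraph is `{u, v}`. -/
theorem connected_induce_top_deleteEdges_iff {V : Type*} [DecidableEq V] {u v : V} (huv : u ≠ v)
    {b : Finset V} (hb : b.Nonempty) :
    (((⊤ : SimpleGraph V).deleteEdges {s(u, v)}).induce (b : Set V)).Connected ↔
      b ≠ {u, v} := by
  constructor
  · rintro h rfl
    obtain ⟨p⟩ := h.preconnected ⟨u, by simp⟩ ⟨v, by simp⟩
    cases p with
    | nil => exact huv rfl
    | @cons _ w _ hadj _ =>
      obtain ⟨w, hw⟩ := w
      simp only [Finset.coe_insert, Finset.coe_singleton, Set.mem_insert_iff,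
        Set.mem_singleton_iff] at hw
      rcases hw with rfl | rfl <;> simp at hadj
  · intro hne
    have : Nonempty (b : Set V) := hb.to_subtype
    refine ⟨?_⟩
    rintro ⟨x, hx⟩ ⟨y, hy⟩
    have adj_reach : ∀ (x y : (b : Set V)), s(x.1, y.1) ≠ s(u, v) →
        (((⊤ : SimpleGraph V).deleteEdges {s(u, v)}).induce (b : Set V)).Reachable x y := by
      intro x y hxy
      by_cases h : x = y
      · rw [h]
      · refine SimpleGraph.Adj.reachable ?_
        rw [SimpleGraph.induce_adj, SimpleGraph.deleteEdges_adj]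
        exact ⟨fun h' ↦ h (Subtype.ext h'), hxy⟩
    by_cases hxy : s(x, y) = s(u, v)
    · have hsub : {u, v} ⊆ b := by
        intro z hz
        have hz' : z ∈ s(u, v) := by simpa using hz
        rw [← hxy, Sym2.mem_iff] at hz'
        rcases hz' with rfl | rfl
        exacts [hx, hy]
      obtain ⟨w, hw, hwuv⟩ := Finset.exists_of_ssubset (hsub.ssubset_of_ne hne.symm)
      have hw' : w ∉ s(u, v) := by simpa using hwuv
      exact (adj_reach ⟨x, hx⟩ ⟨w, hw⟩ fun h ↦ hw' (h ▸ Sym2.mem_mk_right x w)).trans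
        (adj_reach ⟨w, hw⟩ ⟨y, hy⟩ fun h ↦ hw' (h ▸ Sym2.mem_mk_left w y))
    · exact adj_reach _ _ hxy

/-- For `n ≥ 2`, the complete graph on `n` vertices with one edge removed has exactly
`B(n) - B(n-2)` compositions. -/
theorem numComp_complete_minus_edge (n : ℕ) (hn : 2 ≤ n) (u v : Fin n) (huv : u ≠ v) :
    numComp ((⊤ : SimpleGraph (Fin n)).deleteEdges {s(u, v)}) = bell n - bell (n - 2) := by
  have hgood : ∀ P : Finpartition (Finset.univ : Finset (Fin n)),
      (∀ b ∈ P.parts,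
        (((⊤ : SimpleGraph (Fin n)).deleteEdges {s(u, v)}).induce (b : Set (Fin n))).Connected) ↔
      ¬ ({u, v} ∈ P.parts) := by
    intro P
    constructor
    · intro h hP
      exact (connected_induce_top_deleteEdges_iff huv (P.nonempty_of_mem_parts hP)).1 (h _ hP) rfl
    · intro h b hb
      exact (connected_induce_top_deleteEdges_iff huv (P.nonempty_of_mem_parts hb)).2
        fun hbe ↦ h (hbe ▸ hb)
  have hbad : Nat.card {P : Finpartition (Finset.univ : Finset (Fin n)) // {u, v} ∈ P.parts} =
      bell (n - 2) := by
    rw [card_finpartition_mem_parts (Finset.insert_nonempty _ _) (Finset.subset_univ _),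
      card_finpartition_eq_bell, Finset.card_sdiff_of_subset (Finset.subset_univ _),
      Finset.card_pair huv, Finset.card_univ, Fintype.card_fin]
  rw [numComp, Nat.card_congr (Equiv.subtypeEquivRight hgood), ← hbad, bell,
    Nat.card_eq_fintype_card, Nat.card_eq_fintype_card, Nat.card_eq_fintype_card,
    Fintype.card_subtype_compl]
end

section
/- For every integer n ≥ 3, the number of compositions of the cycle graph C_n on n vertices equals 2^n − n. -/
namespace CycleComposition

open Finset Relation

variable {n : ℕ}

lemma neg_one_eq_last : (-1 : Fin (n + 2)) = Fin.last (n + 1) :=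
  Fin.ext Fin.coe_neg_one

/-- The vertices `i` whose successor `i + 1` lies in another block of `P`. -/
def cut (P : Finpartition (univ : Finset (Fin (n + 2)))) : Finset (Fin (n + 2)) :=
  {i | P.part i ≠ P.part (i + 1)}

lemma mem_cut {P : Finpartition (univ : Finset (Fin (n + 2)))} {i : Fin (n + 2)} :
    i ∈ cut P ↔ P.part i ≠ P.part (i + 1) := by
  simp [cut]

/-- `b` is the successor of `a`, and there is no cut between them. -/
def Uncut (S : Finset (Fin (n + 2))) (a b : Fin (n + 2)) : Prop :=
  b = a + 1 ∧ a ∉ S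

lemma card_cut_ne_one (P : Finpartition (univ : Finset (Fin (n + 2)))) : #(cut P) ≠ 1 := by
  intro h
  obtain ⟨i, hi⟩ := card_eq_one.mp h
  have key (v : Fin (n + 2)) : P.part (i + 1 + v) = P.part (i + 1) := by
    induction v using Fin.induction with
    | zero => simp
    | succ t ih =>
      rw [← ih, ← Fin.coeSucc_eq_succ, ← add_assoc]
      have hne : i + 1 + t.castSucc ∉ cut P := by
        rw [hi, mem_singleton, add_assoc, add_eq_left, add_comm (1 : Fin (n + 2)),
          Fin.coeSucc_eq_succ]
        exact Fin.succ_ne_zero t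
      rw [mem_cut, not_not] at hne
      exact hne.symm
  have hmem : i ∈ cut P := by simp [hi]
  refine mem_cut.mp hmem ?_
  simpa using key (-1)

lemma part_eq_iff_eqvGen {P : Finpartition (univ : Finset (Fin (n + 2)))}
    (hP : ∀ b ∈ P.parts, ((SimpleGraph.cycleGraph (n + 2)).induce (b : Set _)).Connected)
    (a b : Fin (n + 2)) : P.part a = P.part b ↔ EqvGen (Uncut (cut P)) a b := by
  constructor
  · intro h
    have ha : a ∈ P.part b := h ▸ P.mem_part (mem_univ a)
    have hreach := (hP (P.part b) (P.part_mem.2 (mem_univ b))).preconnected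
      ⟨a, ha⟩ ⟨b, P.mem_part (mem_univ b)⟩
    rw [SimpleGraph.reachable_iff_reflTransGen] at hreach
    have step (x y : (P.part b : Set (Fin (n + 2)))) (hxy : y.1 = x.1 + 1) :
        EqvGen (Uncut (cut P)) x.1 y.1 := by
      refine .rel _ _ ⟨hxy, ?_⟩
      rw [mem_cut, not_not, ← hxy,
        (P.mem_part_iff_part_eq_part (mem_univ _) (mem_univ _)).1 x.2,
        (P.mem_part_iff_part_eq_part (mem_univ _) (mem_univ _)).1 y.2]
    suffices ∀ x y, ReflTransGen
        ((SimpleGraph.cycleGraph (n + 2)).induce (P.part b : Set _)).Adj x y →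
        EqvGen (Uncut (cut P)) x.1 y.1 from this _ _ hreach
    intro x y hxy
    induction hxy with
    | refl => exact .refl _
    | @tail y z _ hyz ih =>
      refine ih.trans _ _ _ ?_
      rw [SimpleGraph.comap_adj] at hyz
      rcases SimpleGraph.cycleGraph_adj.1 hyz with h | h
      · exact (step z y (sub_eq_iff_eq_add'.1 h)).symm
      · exact step y z (sub_eq_iff_eq_add'.1 h)
  · intro h
    induction h with
    | rel x y h =>
      obtain ⟨rfl, h⟩ := h
      simpa [mem_cut] using h
    | refl => rfl
    | symm _ _ _ ih => exact ih.symm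
    | trans _ _ _ _ _ ih₁ ih₂ => exact ih₁.trans ih₂

lemma finpartition_ext_part {α : Type*} [DecidableEq α] {s : Finset α} {P Q : Finpartition s}
    (h : ∀ a ∈ s, P.part a = Q.part a) : P = Q := by
  have key {P Q : Finpartition s} (h : ∀ a ∈ s, P.part a = Q.part a) : P.parts ⊆ Q.parts := by
    intro t ht
    obtain ⟨a, ha⟩ := P.nonempty_of_mem_parts ht
    have has := P.le ht ha
    rw [← P.part_eq_of_mem ht ha, h a has]
    exact Q.part_mem.2 has
  exact Finpartition.ext ((key h).antisymm (key fun a ha ↦ (h a ha).symm))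

lemma eq_of_cut_eq {P Q : Finpartition (univ : Finset (Fin (n + 2)))}
    (hP : ∀ b ∈ P.parts, ((SimpleGraph.cycleGraph (n + 2)).induce (b : Set _)).Connected)
    (hQ : ∀ b ∈ Q.parts, ((SimpleGraph.cycleGraph (n + 2)).induce (b : Set _)).Connected)
    (h : cut P = cut Q) : P = Q := by
  refine finpartition_ext_part fun a _ ↦ ?_
  ext b
  rw [P.mem_part_iff_part_eq_part (mem_univ _) (mem_univ _),
    Q.mem_part_iff_part_eq_part (mem_univ _) (mem_univ _),
    part_eq_iff_eqvGen hP, part_eq_iff_eqvGen hQ, h]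

/-- Two cuts `i ≠ j` separate the arc from `i + 1` to `j` from the rest of the cycle. -/
lemma sub_le_iff_of_eqvGen {S : Finset (Fin (n + 2))} {i j a b : Fin (n + 2)} (hi : i ∈ S)
    (hj : j ∈ S) (h : EqvGen (Uncut S) a b) :
    a - (i + 1) ≤ j - (i + 1) ↔ b - (i + 1) ≤ j - (i + 1) := by
  induction h with
  | rel k l h =>
    obtain ⟨rfl, hk⟩ := h
    have hki : k - (i + 1) ≠ Fin.last (n + 1) := by
      rw [← neg_one_eq_last]
      intro h
      apply hk
      rw [sub_eq_iff_eq_add] at h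
      rwa [h, neg_add_cancel_comm_assoc]
    have hkj : k - (i + 1) ≠ j - (i + 1) := fun h ↦ hk (sub_left_injective h ▸ hj)
    have hsucc := Fin.val_add_one (k - (i + 1))
    rw [if_neg hki] at hsucc
    rw [add_sub_right_comm, Fin.le_def, Fin.le_def, hsucc]
    have := Fin.val_ne_of_ne hkj
    omega
  | refl => rfl
  | symm _ _ _ ih => exact ih.symm
  | trans _ _ _ _ _ ih₁ ih₂ => exact ih₁.trans ih₂

lemma not_eqvGen_of_mem {S : Finset (Fin (n + 2))} (hS : #S ≠ 1) {i : Fin (n + 2)} (hi : i ∈ S) :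
    ¬ EqvGen (Uncut S) i (i + 1) := by
  intro h
  obtain ⟨j, hj, hji⟩ : ∃ j ∈ S, j ≠ i := by
    by_contra! hall
    exact hS (card_eq_one.2 ⟨i, eq_singleton_iff_unique_mem.2 ⟨hi, hall⟩⟩)
  have hle := (sub_le_iff_of_eqvGen hi hj h).2 (by simp)
  rw [show i - (i + 1) = Fin.last (n + 1) by simp [← neg_one_eq_last], Fin.last_le_iff,
    ← neg_one_eq_last, sub_eq_iff_eq_add, neg_add_cancel_comm_assoc] at hle
  exact hji hle

lemma exists_cut_eq {S : Finset (Fin (n + 2))} (hS : #S ≠ 1) :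
    ∃ P : Finpartition (univ : Finset (Fin (n + 2))),
      (∀ b ∈ P.parts, ((SimpleGraph.cycleGraph (n + 2)).induce (b : Set _)).Connected) ∧
      cut P = S := by
  classical
  let P := Finpartition.ofSetoid (EqvGen.setoid (Uncut S))
  have hpart (a b : Fin (n + 2)) : b ∈ P.part a ↔ EqvGen (Uncut S) a b :=
    Finpartition.mem_part_ofSetoid_iff_rel
  refine ⟨P, fun t ht ↦ ?_, ?_⟩
  · obtain ⟨c, hc⟩ := P.nonempty_of_mem_parts ht
    obtain rfl := P.part_eq_of_mem ht hc
    have key (a b : Fin (n + 2)) (h : EqvGen (Uncut S) a b) (ha : a ∈ P.part c)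
        (hb : b ∈ P.part c) :
        ((SimpleGraph.cycleGraph (n + 2)).induce (P.part c : Set _)).Reachable
          ⟨a, ha⟩ ⟨b, hb⟩ := by
      induction h with
      | rel x y h =>
        refine SimpleGraph.Adj.reachable ?_
        rw [SimpleGraph.comap_adj]
        exact SimpleGraph.cycleGraph_adj.2 (.inr (sub_eq_iff_eq_add'.2 h.1))
      | refl => rfl
      | symm _ _ _ ih => exact (ih hb ha).symm
      | trans x y z hxy _ ih₁ ih₂ =>
        have hy : y ∈ P.part c := (hpart _ _).2 (.trans _ _ _ ((hpart _ _).1 ha) hxy)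
        exact (ih₁ ha hy).trans (ih₂ hy hb)
    rw [SimpleGraph.connected_iff]
    refine ⟨fun a b ↦ key a b ?_ a.2 b.2, ⟨⟨c, hc⟩⟩⟩
    exact .trans _ c _ (.symm _ _ ((hpart _ _).1 a.2)) ((hpart _ _).1 b.2)
  · ext i
    rw [mem_cut, ne_comm, ne_eq, ← P.mem_part_iff_part_eq_part (mem_univ _) (mem_univ _), hpart]
    refine ⟨fun h ↦ ?_, not_eqvGen_of_mem hS⟩
    by_contra hi
    exact h (.rel _ _ ⟨rfl, hi⟩)

lemma card_subtype_card_ne_one (α : Type*) [Fintype α] :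
    Nat.card {S : Finset α // #S ≠ 1} = 2 ^ Fintype.card α - Fintype.card α := by
  classical
  rw [Nat.card_eq_fintype_card, Fintype.card_subtype_compl, Fintype.card_finset,
    Fintype.card_finset_len, Nat.choose_one_right]

end CycleComposition

/-- The number of compositions of the cycle graph `C_n` on `n ≥ 3` vertices is `2^n - n`. -/
theorem numComp_cycleGraph (n : ℕ) (hn : 3 ≤ n) :
    numComp (SimpleGraph.cycleGraph n) = 2 ^ n - n := by
  obtain ⟨m, rfl⟩ := Nat.exists_eq_add_of_le' (show 2 ≤ n by omega)
  have hcard := CycleComposition.card_subtype_card_ne_one (Fin (m + 2))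
  rw [Fintype.card_fin] at hcard
  rw [numComp, ← hcard]
  refine Nat.card_congr (Equiv.ofBijective
    (fun P ↦ ⟨CycleComposition.cut P.1, CycleComposition.card_cut_ne_one P.1⟩) ⟨?_, ?_⟩)
  · intro P Q h
    exact Subtype.ext (CycleComposition.eq_of_cut_eq P.2 Q.2 (congrArg Subtype.val h))
  · rintro ⟨S, hS⟩
    obtain ⟨P, hP, hPS⟩ := CycleComposition.exists_cut_eq hS
    exact ⟨⟨P, hP⟩, Subtype.ext hPS⟩
end

section
/- For every integer n ≥ 3, the number of compositions of the cycle graph C_n satisfies C(C_n) = Σ_{d | n} d · L(d) − n, where L(d) is the number of Lyndon compositions of d for d ≥ 2 and L(1) is taken to be 2. -/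
/-- A list of positive integers is a Lyndon composition (of its sum) if it is aperiodic
(not the concatenation of `m ≥ 2` copies of a shorter list) and lexicographically least
among all of its cyclic rotations. -/
def IsLyndonComposition (l : List ℕ) : Prop :=
  (¬ ∃ (p : List ℕ) (m : ℕ), 2 ≤ m ∧ l = (List.replicate m p).flatten) ∧
  ∀ k : ℕ, l ≤ l.rotate k

/-- `numLyndonComp n` is the number of Lyndon compositions of `n`. -/
noncomputable def numLyndonComp (n : ℕ) : ℕ :=
  Nat.card {c : Composition n // IsLyndonComposition c.blocks}

section Lyndon

open List

theorem flatten_replicate_append_head (x : ℕ) (q : List ℕ) (m : ℕ) :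
    (replicate m (x :: q)).flatten ++ [x] = x :: (replicate m (q ++ [x])).flatten := by
  induction m with
  | zero => simp
  | succ m ih => simp [replicate_succ, ih]

theorem rotate_flatten_replicate (p : List ℕ) (m k : ℕ) :
    (replicate m p).flatten.rotate k = (replicate m (p.rotate k)).flatten := by
  induction k generalizing p with
  | zero => simp
  | succ k ih =>
    have h1 : (replicate m p).flatten.rotate 1 = (replicate m (p.rotate 1)).flatten := by
      cases p with
      | nil => simp
      | cons x q =>
        cases m with
        | zero => simp
        | succ m => simp [replicate_succ, flatten_replicate_append_head]
    rw [add_comm, ← rotate_rotate, h1, ih, rotate_rotate]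

theorem flatten_replicate_injective {p q : List ℕ} {m : ℕ} (hm : 0 < m)
    (hl : p.length = q.length)
    (h : (replicate m p).flatten = (replicate m q).flatten) : p = q := by
  obtain ⟨m, rfl⟩ := Nat.exists_eq_add_of_lt hm
  simp only [zero_add, replicate_succ, flatten_cons] at h
  exact (append_inj h hl).1

theorem append_lt_append_of_lt {p q : List ℕ} (hl : p.length = q.length) (h : p < q)
    (s t : List ℕ) : p ++ s < q ++ t := by
  induction p generalizing q with
  | nil => cases q <;> simp_all
  | cons a p ih =>
    cases q with
    | nil => simp at hl
    | cons b q =>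
      rw [List.cons_lt_cons_iff] at h
      rw [cons_append, cons_append, List.cons_lt_cons_iff]
      rcases h with h | ⟨rfl, h⟩
      · exact .inl h
      · exact .inr ⟨rfl, ih (by simpa using hl) h⟩

theorem le_of_flatten_replicate_le {p q : List ℕ} {m : ℕ} (hm : 0 < m)
    (hl : p.length = q.length)
    (h : (replicate m p).flatten ≤ (replicate m q).flatten) : p ≤ q := by
  obtain ⟨m, rfl⟩ := Nat.exists_eq_add_of_lt hm
  by_contra! hlt
  simp only [zero_add, replicate_succ, flatten_cons] at h
  exact absurd (append_lt_append_of_lt hl.symm hlt _ _) (not_lt.2 h)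

theorem eq_flatten_replicate_of_append_comm {u v : List ℕ} {m : ℕ} (hv : v.length = u.length * m)
    (h : v ++ u = u ++ v) : v = (replicate m u).flatten := by
  induction m generalizing v with
  | zero => simpa using hv
  | succ m ih =>
    obtain ⟨w, rfl⟩ : u <+: v := by
      refine prefix_of_prefix_length_le (prefix_append u v) (h ▸ prefix_append v u) ?_
      rw [hv]; nlinarith
    rw [replicate_succ, flatten_cons, ← ih (v := w)]
    · rw [length_append] at hv; linarith
    · simpa using h

theorem rotate_gcd {l : List ℕ} {i j : ℕ} (hi : l.rotate i = l) (hj : l.rotate j = l) :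
    l.rotate (i.gcd j) = l := by
  have key (k : ℕ) (l : List ℕ) : (fun l : List ℕ => l.rotate 1)^[k] l = l.rotate k := by
    induction k generalizing l with
    | zero => simp
    | succ k ih => rw [Function.iterate_succ_apply, ih, rotate_rotate, add_comm]
  have h := Function.IsPeriodicPt.gcd (f := fun l : List ℕ => l.rotate 1) (x := l) (m := i) (n := j)
    ((key i l).trans hi) ((key j l).trans hj)
  exact (key _ l).symm.trans h

/-- Not a proper power. -/
def Aperiodic (l : List ℕ) : Prop :=
  ¬ ∃ (p : List ℕ) (m : ℕ), 2 ≤ m ∧ l = (replicate m p).flatten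

theorem Aperiodic.length_dvd {l : List ℕ} (h : Aperiodic l) {i : ℕ} (hi : l.rotate i = l) :
    l.length ∣ i := by
  set g := i.gcd l.length with hg
  have hr : l.rotate g = l := rotate_gcd hi (rotate_length l)
  obtain ⟨m, hm⟩ : g ∣ l.length := Nat.gcd_dvd_right _ _
  have hlen : 0 < l.length := by
    by_contra h0
    exact h ⟨[], 2, le_rfl, by simpa using h0⟩
  have hm0 : m ≠ 0 := by rintro rfl; omega
  obtain ⟨k, rfl⟩ := Nat.exists_eq_succ_of_ne_zero hm0
  have hgle : g ≤ l.length := Nat.le_of_dvd hlen ⟨_, hm⟩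
  have hd : l.drop g = (replicate k (l.take g)).flatten := by
    apply eq_flatten_replicate_of_append_comm
    · rw [length_drop, length_take, min_eq_left hgle, hm, Nat.mul_succ]; omega
    · rw [← rotate_eq_drop_append_take hgle, hr, take_append_drop]
  have hk : k = 0 := by
    by_contra hk
    refine h ⟨l.take g, k + 1, by omega, ?_⟩
    rw [replicate_succ, flatten_cons, ← hd, take_append_drop]
  subst hk
  rw [hm, Nat.succ_eq_add_one, zero_add, mul_one]
  exact Nat.gcd_dvd_left _ _

theorem Aperiodic.ne_nil {l : List ℕ} (h : Aperiodic l) : l ≠ [] := by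
  rintro rfl
  exact h ⟨[], 2, le_rfl, rfl⟩

theorem Aperiodic.eq_of_flatten_replicate_eq {p q : List ℕ} (hp : Aperiodic p) (hq : Aperiodic q)
    {a b : ℕ} (ha : 0 < a) (hb : 0 < b)
    (h : (replicate a p).flatten = (replicate b q).flatten) : p = q := by
  have h1 : (replicate a p).flatten.rotate p.length = (replicate a p).flatten := by
    rw [rotate_flatten_replicate, rotate_length]
  have h2 : (replicate b q).flatten.rotate q.length = (replicate b q).flatten := by
    rw [rotate_flatten_replicate, rotate_length]
  have hpq : p.length ∣ q.length := hp.length_dvd <|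
    flatten_replicate_injective ha (length_rotate _ _) <| by
      rw [← rotate_flatten_replicate, h, h2]
  have hqp : q.length ∣ p.length := hq.length_dvd <|
    flatten_replicate_injective hb (length_rotate _ _) <| by
      rw [← rotate_flatten_replicate, ← h, h1]
  have hl := Nat.dvd_antisymm hpq hqp
  have hab : a = b := by
    have := congrArg length h
    simp only [length_flatten, map_replicate, sum_replicate, smul_eq_mul, hl] at this
    exact Nat.eq_of_mul_eq_mul_right (length_pos_iff.2 hq.ne_nil) this
  subst hab
  exact flatten_replicate_injective ha hl h

theorem flatten_replicate_flatten_replicate (q : List ℕ) (m k : ℕ) :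
    (replicate m (replicate k q).flatten).flatten = (replicate (m * k) q).flatten := by
  induction m with
  | zero => simp
  | succ m ih =>
    rw [replicate_succ, flatten_cons, ih, ← flatten_append, replicate_append_replicate,
      Nat.succ_mul, add_comm]

theorem exists_aperiodic_root {l : List ℕ} (hl : l ≠ []) :
    ∃ (p : List ℕ) (m : ℕ), 0 < m ∧ Aperiodic p ∧ l = (replicate m p).flatten := by
  induction hn : l.length using Nat.strong_induction_on generalizing l with
  | _ n ih =>
    by_cases h : Aperiodic l
    · exact ⟨l, 1, one_pos, h, by simp⟩
    · obtain ⟨p, m, hm, rfl⟩ := not_not.1 h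
      have hp : p ≠ [] := by rintro rfl; simp at hl
      have hp' := length_pos_iff.2 hp
      have hlt : p.length < n := by
        simp only [length_flatten, map_replicate, sum_replicate, smul_eq_mul] at hn
        nlinarith
      obtain ⟨q, k, hk, hq, rfl⟩ := ih _ hlt hp rfl
      refine ⟨q, m * k, by positivity, hq, flatten_replicate_flatten_replicate q m k⟩

theorem exists_rotate_le (l : List ℕ) : ∃ i, ∀ k, l.rotate i ≤ (l.rotate i).rotate k := by
  obtain ⟨c, hc, hmin⟩ := l.cyclicPermutations.toFinset.exists_min_image id
    ⟨l, by simpa [mem_cyclicPermutations_iff] using IsRotated.refl l⟩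
  simp only [mem_toFinset, mem_cyclicPermutations_iff] at hc hmin
  obtain ⟨i, rfl⟩ := hc.symm
  exact ⟨i, fun k => hmin _ ((IsRotated.forall _ k).trans hc)⟩

theorem sum_flatten_replicate (m : ℕ) (p : List ℕ) : (replicate m p).flatten.sum = m * p.sum := by
  simp [sum_flatten]

theorem isLyndonComposition_of_flatten_replicate_le {p : List ℕ} {m : ℕ} (hm : 0 < m) (hp : Aperiodic p)
    (h : ∀ k, (replicate m p).flatten ≤ (replicate m p).flatten.rotate k) :
    IsLyndonComposition p := by
  refine ⟨hp, fun k => le_of_flatten_replicate_le hm (length_rotate _ _).symm ?_⟩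
  rw [← rotate_flatten_replicate]
  exact h k

theorem IsLyndonComposition.flatten_replicate_le {p : List ℕ} (h : IsLyndonComposition p)
    (m k : ℕ) : (replicate m p).flatten ≤ (replicate m p).flatten.rotate k := by
  rw [rotate_flatten_replicate]
  rcases (h.2 k).eq_or_lt with he | hlt
  · rw [← he]
  · cases m with
    | zero => simp
    | succ m =>
      rw [replicate_succ, replicate_succ, flatten_cons, flatten_cons]
      exact (append_lt_append_of_lt (length_rotate _ _).symm hlt _ _).le

theorem IsLyndonComposition.aperiodic {p : List ℕ} (h : IsLyndonComposition p) : Aperiodic p := h.1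

theorem IsLyndonComposition.eq_of_rotate_eq {p q : List ℕ} (hp : IsLyndonComposition p)
    (hq : IsLyndonComposition q) {a b i j : ℕ} (ha : 0 < a) (hb : 0 < b)
    (hi : i < p.length) (hj : j < q.length)
    (h : (replicate a p).flatten.rotate i = (replicate b q).flatten.rotate j) :
    p = q ∧ i = j := by
  have hle {p q : List ℕ} (hp : IsLyndonComposition p) {a b i j : ℕ}
      (h : (replicate a p).flatten.rotate i = (replicate b q).flatten.rotate j) :
      (replicate a p).flatten ≤ (replicate b q).flatten := by
    obtain ⟨k, hk⟩ : (replicate a p).flatten ~r (replicate b q).flatten :=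
      (IsRotated.forall _ i).symm.trans (h ▸ IsRotated.forall _ j)
    exact hk ▸ hp.flatten_replicate_le a k
  have hw := (hle hp h).antisymm (hle hq h.symm)
  obtain rfl := hp.aperiodic.eq_of_flatten_replicate_eq hq.aperiodic ha hb hw
  refine ⟨rfl, ?_⟩
  rw [← hw, rotate_flatten_replicate, rotate_flatten_replicate] at h
  replace h := flatten_replicate_injective ha (by simp) h
  wlog hij : i ≤ j generalizing i j
  · exact (this hj hi h.symm (by omega)).symm
  have h1 : p.rotate (j - i) = p := by
    apply rotate_injective i
    change (p.rotate (j - i)).rotate i = p.rotate i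
    rw [rotate_rotate, Nat.sub_add_cancel hij, h]
  have := Nat.eq_zero_of_dvd_of_lt (hp.aperiodic.length_dvd h1) (by omega)
  omega

theorem exists_lyndon_rotate_eq {c : List ℕ} (hc : c ≠ []) :
    ∃ (p : List ℕ) (m i : ℕ), 0 < m ∧ IsLyndonComposition p ∧ i < p.length ∧
      (replicate m p).flatten.rotate i = c := by
  obtain ⟨i, hi⟩ := exists_rotate_le c
  obtain ⟨p, m, hm, hp, h⟩ := exists_aperiodic_root (l := c.rotate i) (by simpa using hc)
  rw [h] at hi
  obtain ⟨j, hj⟩ : c.rotate i ~r c := IsRotated.forall c i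
  refine ⟨p, m, j % p.length, hm, isLyndonComposition_of_flatten_replicate_le hm hp hi,
    Nat.mod_lt _ (length_pos_iff.2 hp.ne_nil), ?_⟩
  rw [rotate_flatten_replicate, rotate_mod, ← rotate_flatten_replicate, ← h, hj]

/-- The composition of `n` obtained by repeating a composition of a divisor `d` of `n`
and rotating the result by `i`. -/
def rotatedPower {n d : ℕ} (hd : d ∣ n) (c : Composition d) (i : ℕ) : Composition n where
  blocks := (replicate (n / d) c.blocks).flatten.rotate i
  blocks_pos h := by
    rw [mem_rotate, mem_flatten] at h
    obtain ⟨l, hl, h⟩ := h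
    exact c.blocks_pos (eq_of_mem_replicate hl ▸ h)
  blocks_sum := by
    rw [(rotate_perm _ _).sum_eq, sum_flatten_replicate, c.blocks_sum, Nat.div_mul_cancel hd]

theorem head_flatten_replicate_rotate {p : List ℕ} {m : ℕ} (hm : 0 < m) (i : Fin p.length) :
    ((replicate m p).flatten.rotate i).headD 0 = p[i] := by
  obtain ⟨m, rfl⟩ := Nat.exists_eq_add_of_lt hm
  rw [rotate_flatten_replicate, zero_add, replicate_succ, flatten_cons, headD_eq_head?_getD,
    head?_append, head?_rotate i.2]
  simp

theorem sum_headD_blocks_eq_sum_lyndon {n : ℕ} (hn : 0 < n) :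
    ∑ c : Composition n, c.blocks.headD 0 = ∑ d ∈ n.divisors, d * numLyndonComp d := by
  classical
  let e : (Σ d : n.divisors, Σ c : {c : Composition d.1 // IsLyndonComposition c.blocks},
      Fin c.1.blocks.length) → Composition n :=
    fun x => rotatedPower (Nat.dvd_of_mem_divisors x.1.2) x.2.1.1 x.2.2
  have hpos (d : n.divisors) : 0 < n / d.1 :=
    Nat.div_pos (Nat.divisor_le d.2) (Nat.pos_of_mem_divisors d.2)
  have he : Function.Bijective e := by
    constructor
    · rintro ⟨d, ⟨p, hp⟩, i⟩ ⟨d', ⟨q, hq⟩, j⟩ h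
      obtain ⟨h1, h2⟩ := hp.eq_of_rotate_eq hq (hpos d) (hpos d') i.2 j.2
        (congrArg Composition.blocks h)
      have hd : d = d' := Subtype.ext (by rw [← p.blocks_sum, h1, q.blocks_sum])
      subst hd
      obtain rfl : p = q := Composition.ext h1
      obtain rfl : i = j := Fin.ext h2
      rfl
    · intro c
      have hc : c.blocks ≠ [] := by
        intro h
        have := c.blocks_sum
        rw [h, sum_nil] at this
        omega
      obtain ⟨p, m, i, hm, hp, hi, h⟩ := exists_lyndon_rotate_eq hc
      have hs : m * p.sum = n := by
        rw [← c.blocks_sum, ← h, (rotate_perm _ _).sum_eq, sum_flatten_replicate]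
      have hp0 : 0 < p.sum := Nat.pos_of_ne_zero (by rintro h0; simp [h0] at hs; omega)
      refine ⟨⟨⟨p.sum, Nat.mem_divisors.2 ⟨⟨m, by rw [← hs, mul_comm]⟩, hn.ne'⟩⟩,
        ⟨⟨p, fun {x} hx => c.blocks_pos ?_, rfl⟩, hp⟩, ⟨i, hi⟩⟩, Composition.ext ?_⟩
      · rw [← h, mem_rotate, mem_flatten]
        exact ⟨p, mem_replicate.2 ⟨hm.ne', rfl⟩, hx⟩
      · have : n / p.sum = m := by rw [← hs, Nat.mul_div_cancel _ hp0]
        simpa [e, rotatedPower, this] using h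
  rw [← he.sum_comp, Fintype.sum_sigma, ← Finset.sum_coe_sort n.divisors]
  refine Finset.sum_congr rfl fun d _ => ?_
  rw [Fintype.sum_sigma, numLyndonComp, Nat.card_eq_fintype_card, mul_comm, ← smul_eq_mul,
    ← Finset.card_univ, ← Finset.sum_const]
  refine Finset.sum_congr rfl fun c _ => ?_
  simp only [e, rotatedPower, head_flatten_replicate_rotate (hpos d)]
  simp only [Fin.getElem_fin, Fin.sum_univ_getElem, c.1.blocks_sum]

/-- Prepending a first block `j + 1`. -/
def consComposition {n : ℕ} (j : Fin n) (c : Composition (n - 1 - j)) : Composition n where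
  blocks := (j + 1) :: c.blocks
  blocks_pos {i} h := by
    rcases mem_cons.1 h with rfl | h
    · omega
    · exact c.blocks_pos h
  blocks_sum := by rw [sum_cons, c.blocks_sum]; omega

theorem sum_headD_blocks (n : ℕ) (hn : 0 < n) :
    ∑ c : Composition n, c.blocks.headD 0 + 1 = 2 ^ n := by
  let e : (Σ j : Fin n, Composition (n - 1 - j)) → Composition n :=
    fun x => consComposition x.1 x.2
  have he : Function.Bijective e := by
    constructor
    · rintro ⟨j, c⟩ ⟨k, d⟩ h
      have h := congrArg Composition.blocks h
      simp only [e, consComposition, cons.injEq, Nat.add_right_cancel_iff, Fin.val_inj] at h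
      obtain ⟨rfl, h⟩ := h
      rw [Composition.ext h]
    · rintro ⟨_ | ⟨a, l⟩, hp, hs⟩
      · simp at hs; omega
      · have ha : 0 < a := hp mem_cons_self
        rw [sum_cons] at hs
        refine ⟨⟨⟨a - 1, by omega⟩, ⟨l, fun h => hp (mem_cons_of_mem _ h), ?_⟩⟩, ?_⟩
        · simp only; omega
        · apply Composition.ext
          simp only [e, consComposition, cons.injEq, and_true]
          omega
  rw [← he.sum_comp, Fintype.sum_sigma]
  simp only [e, consComposition, headD_cons, Finset.sum_const, Finset.card_univ, composition_card,
    smul_eq_mul]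
  rw [Fin.sum_univ_eq_sum_range (fun j => 2 ^ (n - 1 - j - 1) * (j + 1)) n,
    ← Finset.sum_range_reflect]
  have h1 (n : ℕ) : ∑ m ∈ Finset.range (n + 1), 2 ^ (m - 1) = 2 ^ n := by
    induction n with
    | zero => simp
    | succ n ih => rw [Finset.sum_range_succ, ih, Nat.add_sub_cancel, pow_succ, mul_two]
  have h2 (n : ℕ) : ∑ m ∈ Finset.range n, 2 ^ (m - 1) * (n - m) + 1 = 2 ^ n := by
    induction n with
    | zero => simp
    | succ n ih =>
      have h3 : ∑ m ∈ Finset.range (n + 1), 2 ^ (m - 1) * (n + 1 - m) =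
          ∑ m ∈ Finset.range (n + 1), (2 ^ (m - 1) * (n - m) + 2 ^ (m - 1)) := by
        refine Finset.sum_congr rfl fun m hm => ?_
        rw [Nat.succ_sub (Finset.mem_range_succ_iff.1 hm), Nat.mul_succ]
      rw [h3, Finset.sum_add_distrib, h1, Finset.sum_range_succ, Nat.sub_self, mul_zero, add_zero,
        add_right_comm, ih, pow_succ, mul_two]
  rw [← h2 n]
  congr 1
  refine Finset.sum_congr rfl fun m hm => ?_
  have := Finset.mem_range.1 hm
  congr 2 <;> omega

theorem numLyndonComp_one : numLyndonComp 1 = 1 := by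
  have h := sum_headD_blocks 1 one_pos
  rw [sum_headD_blocks_eq_sum_lyndon one_pos] at h
  simpa using h

theorem sum_divisors_mul_numLyndonComp {n : ℕ} (hn : 0 < n) :
    ∑ d ∈ n.divisors, d * (if d = 1 then 2 else numLyndonComp d) = 2 ^ n := by
  rw [← sum_headD_blocks n hn, sum_headD_blocks_eq_sum_lyndon hn]
  have h1 : 1 ∈ n.divisors := Nat.one_mem_divisors.2 hn.ne'
  rw [← Finset.add_sum_erase _ _ h1, ← Finset.add_sum_erase _ _ h1, numLyndonComp_one,
    Finset.sum_congr rfl fun d hd => by rw [if_neg (Finset.ne_of_mem_erase hd)]]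
  simp only [if_true]
  omega

end Lyndon

section Cycle

open Finset

variable {n : ℕ}

open scoped Fin.NatCast Fin.CommRing in
theorem apply_eq_apply_add_one_of_forall_ne {α : Type*} (f : Fin (n + 2) → α) (i : Fin (n + 2))
    (h : ∀ j ≠ i, f j = f (j + 1)) : f i = f (i + 1) := by
  have key (k : ℕ) (hk : k < n + 2) : f (i + 1 + (k : Fin (n + 2))) = f (i + 1) := by
    induction k with
    | zero => simp
    | succ k ih =>
      rw [← ih (by omega), Nat.cast_succ, ← add_assoc]
      refine (h _ fun h0 => ?_).symm
      rw [add_assoc, add_eq_left, add_comm 1, ← Nat.cast_succ, Fin.natCast_eq_zero] at h0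
      exact absurd (Nat.le_of_dvd (by omega) h0) (by omega)
  rw [← key (n + 1) (by omega), add_assoc, add_comm 1, ← Nat.cast_succ]
  simp

/-- Vertices of the cycle joined by a path avoiding the edges `(x, x + 1)`, `x ∈ S`. -/
def cutSetoid (S : Finset (Fin (n + 2))) : Setoid (Fin (n + 2)) :=
  Relation.EqvGen.setoid fun x y => y = x + 1 ∧ x ∉ S

theorem cutSetoid_succ {S : Finset (Fin (n + 2))} {x : Fin (n + 2)} (h : x ∉ S) :
    cutSetoid S x (x + 1) :=
  .rel _ _ ⟨rfl, h⟩

theorem not_cutSetoid_of_lt {S : Finset (Fin (n + 2))} {i j : Fin (n + 2)} (hi : i ∈ S)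
    (hj : j ∈ S) (hij : i < j) : ¬ cutSetoid S i (i + 1) ∧ ¬ cutSetoid S j (j + 1) := by
  have key {x y : Fin (n + 2)} (h : cutSetoid S x y) : (i < x ∧ x ≤ j) ↔ (i < y ∧ y ≤ j) := by
    induction h with
    | rel x y h =>
      obtain ⟨rfl, hx⟩ := h
      have hxi : x ≠ i := by rintro rfl; exact hx hi
      have hxj : x ≠ j := by rintro rfl; exact hx hj
      simp only [Fin.lt_def, Fin.le_def, Fin.val_add_one, Fin.ext_iff, Fin.val_last] at *
      split_ifs <;> omega
    | refl => rfl
    | symm _ _ _ ih => exact ih.symm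
    | trans _ _ _ _ _ ih₁ ih₂ => exact ih₁.trans ih₂
  constructor <;> intro h <;> have h := key h <;>
    simp only [Fin.lt_def, Fin.le_def, Fin.val_add_one, Fin.ext_iff, Fin.val_last] at * <;>
    split_ifs at h <;> omega

theorem cutSetoid_succ_iff {S : Finset (Fin (n + 2))} (hS : #S ≠ 1) {x : Fin (n + 2)} :
    cutSetoid S x (x + 1) ↔ x ∉ S := by
  refine ⟨fun h hx => ?_, cutSetoid_succ⟩
  have h2 : S.Nontrivial := by
    rw [← one_lt_card_iff_nontrivial]
    have := card_pos.2 ⟨x, hx⟩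
    omega
  obtain ⟨y, hy, hne⟩ := h2.exists_ne x
  rcases lt_or_gt_of_ne hne with hlt | hlt
  · exact (not_cutSetoid_of_lt hy hx hlt).2 h
  · exact (not_cutSetoid_of_lt hx hy hlt).1 h

/-- The `x` such that `x` and `x + 1` lie in different parts. -/
def cuts (P : Finpartition (univ : Finset (Fin (n + 2)))) : Finset (Fin (n + 2)) :=
  {x | P.part x ≠ P.part (x + 1)}

theorem card_cuts_ne_one (P : Finpartition (univ : Finset (Fin (n + 2)))) : #(cuts P) ≠ 1 := by
  intro h
  obtain ⟨i, hi⟩ := card_eq_one.1 h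
  have hmem (j) : P.part j ≠ P.part (j + 1) ↔ j = i := by
    rw [← mem_singleton, ← hi, cuts, mem_filter_univ]
  exact (hmem i).2 rfl (apply_eq_apply_add_one_of_forall_ne P.part i fun j hj => not_not.1 (mt (hmem j).1 hj))

theorem part_eq_part_iff_cutSetoid {P : Finpartition (univ : Finset (Fin (n + 2)))}
    (hP : ∀ b ∈ P.parts, ((SimpleGraph.cycleGraph (n + 2)).induce (b : Set (Fin (n + 2)))).Connected)
    {x y : Fin (n + 2)} : P.part x = P.part y ↔ cutSetoid (cuts P) x y := by
  constructor
  · intro h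
    have hx := P.mem_part (mem_univ x)
    have hy : y ∈ P.part x := h ▸ P.mem_part (mem_univ y)
    have hstep {u v : Fin (n + 2)} (hu : u ∈ P.part x) (hv : v ∈ P.part x) (huv : v = u + 1) :
        cutSetoid (cuts P) u v := by
      subst huv
      refine cutSetoid_succ ?_
      rw [cuts, mem_filter_univ, not_not]
      have hb := P.part_mem.2 (mem_univ x)
      rw [P.part_eq_of_mem hb hu, P.part_eq_of_mem hb hv]
    have hr := (hP _ (P.part_mem.2 (mem_univ x))).preconnected ⟨x, hx⟩ ⟨y, hy⟩
    rw [SimpleGraph.reachable_iff_reflTransGen] at hr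
    have key (z) (h : Relation.ReflTransGen ((SimpleGraph.cycleGraph (n + 2)).induce
        (P.part x : Set (Fin (n + 2)))).Adj ⟨x, hx⟩ z) : cutSetoid (cuts P) x z := by
      induction h with
      | refl => exact Setoid.refl' _ _
      | @tail u v _ huv ih =>
        refine Setoid.trans' _ ih ?_
        rw [SimpleGraph.comap_adj, SimpleGraph.cycleGraph_adj] at huv
        rcases huv with h | h
        · exact Setoid.symm' _ (hstep v.2 u.2 (by rw [← h]; simp))
        · exact hstep u.2 v.2 (by rw [← h]; simp)
    exact key _ hr
  · intro h
    induction h with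
    | rel x y h =>
      obtain ⟨rfl, h⟩ := h
      rwa [cuts, mem_filter_univ, not_not] at h
    | refl => rfl
    | symm _ _ _ ih => exact ih.symm
    | trans _ _ _ _ _ ih₁ ih₂ => exact ih₁.trans ih₂

theorem Finpartition.ext_part {α : Type*} [DecidableEq α] {s : Finset α} {P Q : Finpartition s}
    (h : ∀ x ∈ s, P.part x = Q.part x) : P = Q := by
  have hle {P Q : Finpartition s} (h : ∀ x ∈ s, P.part x = Q.part x) : P.parts ⊆ Q.parts := by
    intro b hb
    obtain ⟨x, hx⟩ := P.nonempty_of_mem_parts hb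
    have hxs := P.le hb hx
    rw [← P.part_eq_of_mem hb hx, h x hxs]
    exact Q.part_mem.2 hxs
  exact Finpartition.ext ((hle h).antisymm (hle fun x hx => (h x hx).symm))

theorem eq_of_cuts_eq {P Q : Finpartition (univ : Finset (Fin (n + 2)))}
    (hP : ∀ b ∈ P.parts, ((SimpleGraph.cycleGraph (n + 2)).induce (b : Set (Fin (n + 2)))).Connected)
    (hQ : ∀ b ∈ Q.parts, ((SimpleGraph.cycleGraph (n + 2)).induce (b : Set (Fin (n + 2)))).Connected)
    (h : cuts P = cuts Q) : P = Q := by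
  refine Finpartition.ext_part fun x _ => Finset.ext fun y => ?_
  rw [P.mem_part_iff_part_eq_part (mem_univ y) (mem_univ x),
    Q.mem_part_iff_part_eq_part (mem_univ y) (mem_univ x),
    part_eq_part_iff_cutSetoid hP, part_eq_part_iff_cutSetoid hQ, h]

theorem exists_cuts_eq {S : Finset (Fin (n + 2))} (hS : #S ≠ 1) :
    ∃ P : Finpartition (univ : Finset (Fin (n + 2))),
      (∀ b ∈ P.parts,
        ((SimpleGraph.cycleGraph (n + 2)).induce (b : Set (Fin (n + 2)))).Connected) ∧
      cuts P = S := by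
  classical
  let P := Finpartition.ofSetoid (cutSetoid S)
  have hpart {x y} : y ∈ P.part x ↔ cutSetoid S x y := Finpartition.mem_part_ofSetoid_iff_rel
  refine ⟨P, fun b hb => ?_, ?_⟩
  · obtain ⟨a, ha⟩ := P.nonempty_of_mem_parts hb
    have hb' {x} : x ∈ (b : Set (Fin (n + 2))) ↔ cutSetoid S a x := by
      rw [mem_coe, ← P.part_eq_of_mem hb ha, hpart]
    have key {x y} (h : cutSetoid S x y) (hx : x ∈ (b : Set (Fin (n + 2))))
        (hy : y ∈ (b : Set (Fin (n + 2)))) :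
        ((SimpleGraph.cycleGraph (n + 2)).induce (b : Set (Fin (n + 2)))).Reachable
          ⟨x, hx⟩ ⟨y, hy⟩ := by
      induction h with
      | rel x y h =>
        obtain ⟨rfl, -⟩ := h
        refine SimpleGraph.Adj.reachable ?_
        rw [SimpleGraph.comap_adj, SimpleGraph.cycleGraph_adj]
        exact .inr (by simp)
      | refl => rfl
      | symm _ _ _ ih => exact (ih hy hx).symm
      | trans _ y _ h _ ih₁ ih₂ =>
        have hm := hb'.2 (Setoid.trans' _ (hb'.1 hx) h)
        exact (ih₁ hx hm).trans (ih₂ hm hy)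
    have : Nonempty (b : Set (Fin (n + 2))) := ⟨⟨a, ha⟩⟩
    refine ⟨fun x y => key ?_ x.2 y.2⟩
    exact Setoid.trans' _ (Setoid.symm' _ (hb'.1 x.2)) (hb'.1 y.2)
  · ext x
    rw [cuts, mem_filter_univ, ne_eq, eq_comm,
      ← P.mem_part_iff_part_eq_part (mem_univ _) (mem_univ _), hpart,
      cutSetoid_succ_iff hS, not_not]

theorem numComp_cycleGraph_add (n : ℕ) :
    numComp (SimpleGraph.cycleGraph (n + 2)) + (n + 2) = 2 ^ (n + 2) := by
  have hbij : Function.Bijective fun P : {P : Finpartition (univ : Finset (Fin (n + 2))) //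
      ∀ b ∈ P.parts,
        ((SimpleGraph.cycleGraph (n + 2)).induce (b : Set (Fin (n + 2)))).Connected} =>
      (⟨cuts P.1, card_cuts_ne_one P.1⟩ : {S : Finset (Fin (n + 2)) // #S ≠ 1}) := by
    constructor
    · intro P Q h
      exact Subtype.ext (eq_of_cuts_eq P.2 Q.2 (congrArg Subtype.val h))
    · rintro ⟨S, hS⟩
      obtain ⟨P, hP, rfl⟩ := exists_cuts_eq hS
      exact ⟨⟨P, hP⟩, rfl⟩
  have hone : #{S : Finset (Fin (n + 2)) | #S = 1} = n + 2 := by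
    rw [univ_filter_card_eq, card_powersetCard, card_univ, Fintype.card_fin, Nat.choose_one_right]
  rw [numComp, Nat.card_eq_of_bijective _ hbij, Nat.card_eq_fintype_card, Fintype.card_subtype]
  have h := card_filter_add_card_filter_not (s := univ) fun S : Finset (Fin (n + 2)) => #S = 1
  rw [hone, card_univ, Fintype.card_finset, Fintype.card_fin, add_comm] at h
  exact h

end Cycle

/-- For `n ≥ 3`, the number of compositions of the cycle graph `C_n` satisfies
`C(C_n) = Σ_{d ∣ n} d·L(d) − n`, where `L(1)` is taken to be `2`.
(The subtraction is stated additively to avoid truncated subtraction.) -/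
theorem numComp_cycleGraph_eq_sum_lyndon (n : ℕ) (hn : 3 ≤ n) :
    numComp (SimpleGraph.cycleGraph n) + n =
      ∑ d ∈ n.divisors, d * (if d = 1 then 2 else numLyndonComp d) := by
  obtain ⟨m, rfl⟩ := Nat.exists_eq_add_of_le' (show 2 ≤ n by omega)
  rw [numComp_cycleGraph_add, sum_divisors_mul_numLyndonComp (by omega)]
end

section
/- For every integer n ≥ 4, the number of compositions of the wheel graph W_n on n vertices satisfies C(W_n) = 2^(n−1) − n + 2 + Σ_{d | n−1, d > 1} d · Σ' Π_{i=1}^{k} C(P_{a_i − 1})^{(n−1)/d}, where Σ' ranges over all Lyndon compositions (a_1, …, a_k) of d, C(P_m) = 2^(m−1) is the number of compositions of the path graph on m ≥ 1 vertices, and C(P_0) = 1 by convention. -/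
/-- The wheel graph with `m` outer vertices (so `m + 1` vertices in all): a central
vertex `none` adjacent to every outer vertex, and the outer vertices `some i`
forming a cycle. -/
def wheelGraph (m : ℕ) : SimpleGraph (Option (Fin m)) :=
  SimpleGraph.fromRel (fun u v =>
    (u = none ∧ v ≠ none) ∨ (∃ i j : Fin m, u = some i ∧ v = some j ∧ (i.val + 1) % m = j.val))

/-! ### Compositions of a graph as closed subgraphs -/

section Graph

variable {V : Type*}

/-- A subgraph `H` of `G` (on the same vertices) that contains every edge of `G` joining two
vertices of the same connected component of `H`. -/
def IsClosedSubgraph (G H : SimpleGraph V) : Prop :=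
  H ≤ G ∧ ∀ u v, G.Adj u v → H.Reachable u v → H.Adj u v

/-- The edges of `G` joining `r`-equivalent vertices. -/
def edgesWithin (G : SimpleGraph V) (r : Setoid V) : SimpleGraph V where
  Adj u v := G.Adj u v ∧ r u v
  symm := ⟨fun _ _ h => ⟨h.1.symm, r.symm h.2⟩⟩
  loopless := ⟨fun _ h => h.1.ne rfl⟩

theorem rel_of_reachable_edgesWithin {G : SimpleGraph V} {r : Setoid V} {u v : V}
    (h : (edgesWithin G r).Reachable u v) : r u v := by
  obtain ⟨p⟩ := h
  induction p with
  | nil => exact r.refl _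
  | cons h _ ih => exact r.trans h.2 ih

theorem isClosedSubgraph_edgesWithin (G : SimpleGraph V) (r : Setoid V) :
    IsClosedSubgraph G (edgesWithin G r) :=
  ⟨fun _ _ h => h.1, fun _ _ h h' => ⟨h, rel_of_reachable_edgesWithin h'⟩⟩

/-- The relation of lying in the same block of a finite partition. -/
def Finpartition.blockSetoid [Fintype V] [DecidableEq V]
    (P : Finpartition (Finset.univ : Finset V)) : Setoid V where
  r u v := P.part u = P.part v
  iseqv := ⟨fun _ => rfl, fun h => h.symm, fun h h' => h.trans h'⟩

theorem Finpartition.eq_of_part_eq [Fintype V] [DecidableEq V]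
    {P Q : Finpartition (Finset.univ : Finset V)} (h : ∀ u, P.part u = Q.part u) : P = Q := by
  have key : ∀ P Q : Finpartition (Finset.univ : Finset V), (∀ u, P.part u = Q.part u) →
      P.parts ⊆ Q.parts := by
    intro P Q h b hb
    obtain ⟨u, hu⟩ := P.nonempty_of_mem_parts hb
    rw [← P.part_eq_of_mem hb hu, h]
    exact Q.part_mem.2 (Finset.mem_univ _)
  exact Finpartition.ext ((key P Q h).antisymm (key Q P fun u => (h u).symm))

theorem reachable_edgesWithin_blockSetoid [Fintype V] [DecidableEq V] {G : SimpleGraph V}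
    {P : Finpartition (Finset.univ : Finset V)}
    (hP : ∀ b ∈ P.parts, (G.induce (b : Set V)).Connected) (u v : V) :
    (edgesWithin G P.blockSetoid).Reachable u v ↔ P.part u = P.part v := by
  refine ⟨rel_of_reachable_edgesWithin, fun h => ?_⟩
  have hu : u ∈ P.part u := P.mem_part_self.2 (Finset.mem_univ _)
  have hv : v ∈ P.part u := h ▸ P.mem_part_self.2 (Finset.mem_univ _)
  have hb : P.part u ∈ P.parts := P.part_mem.2 (Finset.mem_univ _)
  let f : G.induce (P.part u : Set V) →g edgesWithin G P.blockSetoid :=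
    ⟨Subtype.val, fun {a b} hab => ⟨hab, by
      change P.part a = P.part b
      rw [P.part_eq_of_mem hb a.2, P.part_eq_of_mem hb b.2]⟩⟩
  exact ((hP _ hb).preconnected ⟨u, hu⟩ ⟨v, hv⟩).map f

theorem numComp_eq_card_isClosedSubgraph [Fintype V] [DecidableEq V] (G : SimpleGraph V) :
    numComp G = Nat.card {H : SimpleGraph V // IsClosedSubgraph G H} := by
  classical
  refine Nat.card_eq_of_bijective
    (fun P => ⟨edgesWithin G P.1.blockSetoid, isClosedSubgraph_edgesWithin _ _⟩) ⟨?_, ?_⟩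
  · rintro ⟨P, hP⟩ ⟨Q, hQ⟩ h
    have h : edgesWithin G P.blockSetoid = edgesWithin G Q.blockSetoid := congrArg Subtype.val h
    refine Subtype.ext (Finpartition.eq_of_part_eq fun u => Finset.ext fun v => ?_)
    rw [P.mem_part_iff_part_eq_part (Finset.mem_univ _) (Finset.mem_univ _),
      Q.mem_part_iff_part_eq_part (Finset.mem_univ _) (Finset.mem_univ _),
      ← reachable_edgesWithin_blockSetoid hP, ← reachable_edgesWithin_blockSetoid hQ, h]
  · rintro ⟨H, hle, hH⟩
    have hpart : ∀ u v, v ∈ (Finpartition.ofSetoid H.reachableSetoid).part u ↔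
        H.Reachable u v := fun u v => Finpartition.mem_part_ofSetoid_iff_rel
    refine ⟨⟨Finpartition.ofSetoid H.reachableSetoid, fun b hb => ?_⟩, ?_⟩
    · obtain ⟨u, hu⟩ := Finpartition.nonempty_of_mem_parts _ hb
      have hbu : (b : Set V) = (H.connectedComponentMk u).supp := by
        ext v
        rw [← Finpartition.part_eq_of_mem _ hb hu, Finset.mem_coe, hpart,
          SimpleGraph.ConnectedComponent.mem_supp_iff, SimpleGraph.ConnectedComponent.eq]
        exact SimpleGraph.reachable_comm
      rw [hbu]
      exact (H.connectedComponentMk u).connected_toSimpleGraph.mono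
        (SimpleGraph.comap_monotone _ hle)
    · refine Subtype.ext (SimpleGraph.ext (funext fun u => funext fun v => propext ?_))
      have h : (Finpartition.ofSetoid H.reachableSetoid).part u =
          (Finpartition.ofSetoid H.reachableSetoid).part v ↔ H.Reachable u v := by
        rw [← Finpartition.mem_part_iff_part_eq_part _ (Finset.mem_univ _) (Finset.mem_univ _),
          hpart, SimpleGraph.reachable_comm]
      exact ⟨fun h' => hH u v h'.1 (h.1 h'.2), fun h' => ⟨hle h', h.2 h'.reachable⟩⟩

theorem IsClosedSubgraph.eq_of_adj_iff {G H K : SimpleGraph V} (hH : IsClosedSubgraph G H)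
    (hK : IsClosedSubgraph G K) (h : ∀ u v, G.Adj u v → (H.Adj u v ↔ K.Adj u v)) : H = K :=
  SimpleGraph.ext (funext fun u => funext fun v => propext
    ⟨fun h' => (h u v (hH.1 h')).1 h', fun h' => (h u v (hK.1 h')).2 h'⟩)

/-- The finest equivalence relation that identifies the endpoints of each pair in `E`. -/
def pairsSetoid (E : V → V → Prop) : Setoid V where
  r u v := ∀ p : V → Prop, (∀ a b, E a b → (p a ↔ p b)) → (p u ↔ p v)
  iseqv := ⟨fun _ _ _ => Iff.rfl, fun h p hp => (h p hp).symm,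
    fun h h' p hp => (h p hp).trans (h' p hp)⟩

theorem pairsSetoid_of {E : V → V → Prop} {u v : V} (h : E u v) : pairsSetoid E u v :=
  fun _ hp => hp _ _ h

end Graph

theorem numComp_pathGraph_succ (k : ℕ) : numComp (SimpleGraph.pathGraph (k + 1)) = 2 ^ k := by
  have hset : Nat.card (Set (Fin k)) = 2 ^ k := by simp
  rw [numComp_eq_card_isClosedSubgraph, ← hset]
  refine Nat.card_eq_of_bijective (fun H => {i | H.1.Adj i.castSucc i.succ}) ⟨?_, ?_⟩
  · rintro ⟨H, hH⟩ ⟨K, hK⟩ h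
    have h : ∀ i : Fin k, H.Adj i.castSucc i.succ ↔ K.Adj i.castSucc i.succ :=
      fun i => Set.ext_iff.1 h i
    have key : ∀ u v : Fin (k + 1), u.val + 1 = v.val → (H.Adj u v ↔ K.Adj u v) := by
      intro u v huv
      have hu : u.val < k := by omega
      obtain rfl : v = (⟨u, hu⟩ : Fin k).succ := Fin.ext huv.symm
      exact h ⟨u, hu⟩
    refine Subtype.ext (hH.eq_of_adj_iff hK fun u v huv => ?_)
    rcases SimpleGraph.pathGraph_adj.1 huv with h' | h'
    · exact key u v h'
    · rw [H.adj_comm, K.adj_comm]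
      exact key v u h'
  · intro S
    let E : Fin (k + 1) → Fin (k + 1) → Prop := fun u v => ∃ i ∈ S, u = i.castSucc ∧ v = i.succ
    refine ⟨⟨_, isClosedSubgraph_edgesWithin _ (pairsSetoid E)⟩, Set.ext fun i => ?_⟩
    refine ⟨fun h => ?_, fun hi => ⟨?_, pairsSetoid_of ⟨i, hi, rfl, rfl⟩⟩⟩
    · by_contra hi
      have := h.2 (fun x => x ≤ i.castSucc) (by
        rintro _ _ ⟨j, hj, rfl, rfl⟩
        have hij : j ≠ i := fun h => hi (h ▸ hj)
        simp only [Fin.le_def, Fin.val_castSucc, Fin.val_succ]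
        have := Fin.val_ne_of_ne hij
        omega)
      simp [Fin.le_def] at this
    · simp [SimpleGraph.pathGraph_adj]

theorem numComp_pathGraph_zero : numComp (SimpleGraph.pathGraph 0) = 1 := by
  rw [numComp_eq_card_isClosedSubgraph, Nat.card_eq_one_iff_unique]
  exact ⟨inferInstance, ⟨⟨⊥, bot_le, fun u => u.elim0⟩⟩⟩

section Wheel

variable {k : ℕ}

theorem wheelGraph_adj_none_some (m : ℕ) (i : Fin m) : (wheelGraph m).Adj none (some i) := by
  simp [wheelGraph]

theorem wheelGraph_adj_some_some {i j : Fin (k + 3)} :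
    (wheelGraph (k + 3)).Adj (some i) (some j) ↔ i = j - 1 ∨ j = i - 1 := by
  have key : ∀ i j : Fin (k + 3), (i.val + 1) % (k + 3) = j.val ↔ i = j - 1 := by
    intro i j
    rw [eq_sub_iff_add_eq, Fin.ext_iff, Fin.val_add]
    simp
  have hne : ∀ i : Fin (k + 3), i ≠ i - 1 := fun i h =>
    absurd (sub_eq_self.1 h.symm) (by simp)
  simp only [wheelGraph, SimpleGraph.fromRel_adj, ne_eq, Option.some.injEq, reduceCtorEq,
    false_and, false_or, not_false_eq_true]
  constructor
  · rintro ⟨-, ⟨a, b, rfl, rfl, h⟩ | ⟨a, b, rfl, rfl, h⟩⟩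
    · exact Or.inl ((key _ _).1 h)
    · exact Or.inr ((key _ _).1 h)
  · rintro (h | h)
    · exact ⟨fun h' => hne j (h' ▸ h), Or.inl ⟨i, j, rfl, rfl, (key _ _).2 h⟩⟩
    · exact ⟨fun h' => hne i (h' ▸ h), Or.inr ⟨j, i, rfl, rfl, (key _ _).2 h⟩⟩

open scoped Classical in
/-- The labelling of the rim of a wheel attached to a subgraph `H`: a vertex gets `0` if it is
joined to the hub, `1` if it is not but is joined to its predecessor, and `2` otherwise. -/
noncomputable def rimLabel (H : SimpleGraph (Option (Fin (k + 3)))) (i : Fin (k + 3)) : Fin 3 :=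
  if H.Adj none (some i) then 0 else if H.Adj (some (i - 1)) (some i) then 1 else 2

theorem rimLabel_eq_zero {H : SimpleGraph (Option (Fin (k + 3)))} {i : Fin (k + 3)} :
    rimLabel H i = 0 ↔ H.Adj none (some i) := by
  unfold rimLabel
  split_ifs <;> simp_all

theorem rimLabel_eq_one {H : SimpleGraph (Option (Fin (k + 3)))} {i : Fin (k + 3)} :
    rimLabel H i = 1 ↔ ¬ H.Adj none (some i) ∧ H.Adj (some (i - 1)) (some i) := by
  unfold rimLabel
  split_ifs <;> simp_all

/-- No label `0` is cyclically followed by a label `1`. -/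
def AvoidsZeroOne (σ : Fin (k + 3) → Fin 3) : Prop :=
  ∀ i, ¬ (σ (i - 1) = 0 ∧ σ i = 1)

/-- All labels but one are `1`, and the remaining one is `2`. -/
def HasUniqueCut (σ : Fin (k + 3) → Fin 3) : Prop :=
  ∃ i, σ i = 2 ∧ ∀ j, j ≠ i → σ j = 1

theorem rimLabel_avoidsZeroOne {H : SimpleGraph (Option (Fin (k + 3)))}
    (hH : IsClosedSubgraph (wheelGraph (k + 3)) H) : AvoidsZeroOne (rimLabel H) := by
  rintro i ⟨h0, h1⟩
  rw [rimLabel_eq_zero] at h0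
  rw [rimLabel_eq_one] at h1
  exact h1.1 (hH.2 _ _ (wheelGraph_adj_none_some _ i) (h0.reachable.trans h1.2.reachable))

theorem not_hasUniqueCut_rimLabel {H : SimpleGraph (Option (Fin (k + 3)))}
    (hH : IsClosedSubgraph (wheelGraph (k + 3)) H) : ¬ HasUniqueCut (rimLabel H) := by
  rintro ⟨i, hi, hj⟩
  have key : ∀ t : Fin (k + 3), H.Reachable (some i) (some (i + t)) := by
    intro t
    induction t using Fin.induction with
    | zero => simp
    | succ t ih =>
      have h1 := (rimLabel_eq_one.1 (hj (i + t.succ) (by simp))).2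
      have h2 : i + t.succ - 1 = i + t.castSucc := by
        rw [← Fin.coeSucc_eq_succ]
        abel
      rw [h2] at h1
      exact ih.trans h1.reachable
  have h1 := key (-1)
  rw [← sub_eq_add_neg] at h1
  have h2 := hH.2 _ _ (wheelGraph_adj_some_some.2 (Or.inl rfl)) h1.symm
  by_cases h3 : H.Adj none (some i)
  · rw [rimLabel_eq_zero.2 h3] at hi
    exact absurd hi (by decide)
  · rw [rimLabel_eq_one.2 ⟨h3, h2⟩] at hi
    exact absurd hi (by decide)

theorem adj_iff_rimLabel {H : SimpleGraph (Option (Fin (k + 3)))}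
    (hH : IsClosedSubgraph (wheelGraph (k + 3)) H) (i : Fin (k + 3)) :
    H.Adj (some (i - 1)) (some i) ↔
      rimLabel H i = 1 ∨ (rimLabel H i = 0 ∧ rimLabel H (i - 1) = 0) := by
  rw [rimLabel_eq_one, rimLabel_eq_zero, rimLabel_eq_zero]
  constructor
  · intro h
    by_cases h0 : H.Adj none (some i)
    · exact Or.inr ⟨h0, hH.2 _ _ (wheelGraph_adj_none_some _ _)
        (h0.reachable.trans h.symm.reachable)⟩
    · exact Or.inl ⟨h0, h⟩
  · rintro (h | ⟨h, h'⟩)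
    · exact h.2
    · exact hH.2 _ _ (wheelGraph_adj_some_some.2 (Or.inl rfl))
        (h'.symm.reachable.trans h.reachable)

theorem eq_of_rimLabel_eq {H K : SimpleGraph (Option (Fin (k + 3)))}
    (hH : IsClosedSubgraph (wheelGraph (k + 3)) H) (hK : IsClosedSubgraph (wheelGraph (k + 3)) K)
    (h : rimLabel H = rimLabel K) : H = K := by
  have hhub : ∀ i, H.Adj none (some i) ↔ K.Adj none (some i) := fun i => by
    rw [← rimLabel_eq_zero, ← rimLabel_eq_zero, h]
  have hrim : ∀ i, H.Adj (some (i - 1)) (some i) ↔ K.Adj (some (i - 1)) (some i) := fun i => by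
    rw [adj_iff_rimLabel hH, adj_iff_rimLabel hK, h]
  refine hH.eq_of_adj_iff hK fun u v huv => ?_
  match u, v with
  | none, none => exact absurd rfl huv.ne
  | none, some i => exact hhub i
  | some i, none => rw [H.adj_comm, K.adj_comm]; exact hhub i
  | some i, some j =>
    rcases wheelGraph_adj_some_some.1 huv with rfl | rfl
    · exact hrim j
    · rw [H.adj_comm, K.adj_comm]
      exact hrim i

/-- The pairs of vertices that a labelling of the rim of a wheel declares to be joined. -/
def labelPairs (σ : Fin (k + 3) → Fin 3) (u v : Option (Fin (k + 3))) : Prop :=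
  ∃ i, (σ i = 0 ∧ u = none ∧ v = some i) ∨ (σ i = 1 ∧ u = some (i - 1) ∧ v = some i)

theorem pairsSetoid_hub_iff {σ : Fin (k + 3) → Fin 3} (hσ : AvoidsZeroOne σ) (i : Fin (k + 3)) :
    pairsSetoid (labelPairs σ) none (some i) ↔ σ i = 0 := by
  refine ⟨fun h => ?_, fun h => pairsSetoid_of ⟨i, Or.inl ⟨h, rfl, rfl⟩⟩⟩
  refine (h (fun u => ∀ j, u = some j → σ j = 0) ?_).1 (by simp) i rfl
  rintro _ _ ⟨j, ⟨hj, rfl, rfl⟩ | ⟨hj, rfl, rfl⟩⟩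
  · simpa using hj
  · have h1 : σ (j - 1) ≠ 0 := fun h0 => hσ j ⟨h0, hj⟩
    simp [hj, h1]

theorem pairsSetoid_rim_iff {σ : Fin (k + 3) → Fin 3} (hσ : AvoidsZeroOne σ)
    (hσ' : ¬ HasUniqueCut σ) {i : Fin (k + 3)} (hi : σ i ≠ 0) :
    pairsSetoid (labelPairs σ) (some (i - 1)) (some i) ↔ σ i = 1 := by
  refine ⟨fun h => ?_, fun h => pairsSetoid_of ⟨i, Or.inr ⟨h, rfl, rfl⟩⟩⟩
  by_contra hi1
  obtain ⟨j, hji, hj⟩ : ∃ j, j ≠ i ∧ σ j ≠ 1 := by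
    by_contra! hcon
    exact hσ' ⟨i, by omega, hcon⟩
  have hpos : 0 < (j - i).val := by
    rw [Nat.pos_iff_ne_zero, Fin.val_ne_zero_iff]
    exact sub_ne_zero.2 hji
  have key := (h (fun u => ∃ x, u = some x ∧ σ x ≠ 0 ∧ (x - i).val < (j - i).val) ?_).2
    ⟨i, rfl, hi, by simpa using hpos⟩
  · obtain ⟨x, hx, -, hlt⟩ := key
    obtain rfl := Option.some_injective _ hx
    have h1 : i - 1 - i = -1 := by abel
    rw [h1, Fin.coe_neg_one] at hlt
    have := (j - i).isLt
    omega
  · rintro _ _ ⟨x, ⟨hx, rfl, rfl⟩ | ⟨hx, rfl, rfl⟩⟩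
    · simp [hx]
    · have h1 : σ (x - 1) ≠ 0 := fun h0 => hσ x ⟨h0, hx⟩
      have hxi : x - i ≠ 0 := sub_ne_zero.2 fun h => hi1 (h ▸ hx)
      have hxj : (x - i).val ≠ (j - i).val := fun h => hj (sub_left_injective (Fin.ext h) ▸ hx)
      have h2 : (x - 1 - i).val = (x - i).val - 1 := by
        rw [sub_right_comm, Fin.val_sub_one_of_ne_zero hxi]
      have h3 := Fin.val_ne_zero_iff.2 hxi
      simp only [Option.some.injEq, exists_eq_left', h2, hx]
      simp only [Fin.isValue, ne_eq, h1, not_false_eq_true, true_and, one_ne_zero]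
      omega

theorem exists_isClosedSubgraph_rimLabel_eq {σ : Fin (k + 3) → Fin 3} (hσ : AvoidsZeroOne σ)
    (hσ' : ¬ HasUniqueCut σ) :
    ∃ H, IsClosedSubgraph (wheelGraph (k + 3)) H ∧ rimLabel H = σ := by
  refine ⟨_, isClosedSubgraph_edgesWithin _ (pairsSetoid (labelPairs σ)), funext fun i => ?_⟩
  have h0 : (edgesWithin (wheelGraph (k + 3)) (pairsSetoid (labelPairs σ))).Adj none (some i) ↔
      σ i = 0 :=
    ⟨fun h => (pairsSetoid_hub_iff hσ i).1 h.2,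
      fun h => ⟨wheelGraph_adj_none_some _ _, (pairsSetoid_hub_iff hσ i).2 h⟩⟩
  by_cases hi : σ i = 0
  · rw [rimLabel_eq_zero.2 (h0.2 hi), hi]
  have h1 : (edgesWithin (wheelGraph (k + 3)) (pairsSetoid (labelPairs σ))).Adj
      (some (i - 1)) (some i) ↔ σ i = 1 :=
    ⟨fun h => (pairsSetoid_rim_iff hσ hσ' hi).1 h.2,
      fun h => ⟨wheelGraph_adj_some_some.2 (Or.inl rfl), (pairsSetoid_rim_iff hσ hσ' hi).2 h⟩⟩
  unfold rimLabel
  rw [if_neg (h0.not.2 hi)]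
  split_ifs with h
  · exact (h1.1 h).symm
  · have := h1.not.1 h
    omega

theorem numComp_wheelGraph_eq_card_label :
    numComp (wheelGraph (k + 3)) =
      Nat.card {σ : Fin (k + 3) → Fin 3 // AvoidsZeroOne σ ∧ ¬ HasUniqueCut σ} := by
  rw [numComp_eq_card_isClosedSubgraph]
  refine Nat.card_eq_of_bijective (fun H => ⟨rimLabel H.1, rimLabel_avoidsZeroOne H.2,
    not_hasUniqueCut_rimLabel H.2⟩) ⟨?_, ?_⟩
  · rintro ⟨H, hH⟩ ⟨K, hK⟩ h
    exact Subtype.ext (eq_of_rimLabel_eq hH hK (congrArg Subtype.val h))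
  · rintro ⟨σ, hσ, hσ'⟩
    obtain ⟨H, hH, h⟩ := exists_isClosedSubgraph_rimLabel_eq hσ hσ'
    exact ⟨⟨H, hH⟩, Subtype.ext h⟩

theorem card_hasUniqueCut :
    Nat.card {σ : Fin (k + 3) → Fin 3 // AvoidsZeroOne σ ∧ HasUniqueCut σ} = k + 3 := by
  refine Eq.trans (Eq.symm ?_) (Nat.card_fin (k + 3))
  refine Nat.card_eq_of_bijective (fun i => ⟨Function.update (fun _ => 1) i 2, fun j => ?_,
    i, by simp, fun j hj => by simp [hj]⟩) ⟨?_, ?_⟩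
  · rintro ⟨h, -⟩
    rw [Function.update_apply] at h
    split_ifs at h <;> exact absurd h (by decide)
  · intro i j h
    by_contra hij
    have := congrFun (congrArg Subtype.val h) i
    simp [hij] at this
  · rintro ⟨σ, -, i, hi, hj⟩
    refine ⟨i, Subtype.ext (funext fun j => ?_)⟩
    by_cases h : j = i
    · simp [h, hi]
    · simp [h, hj j h]

theorem numComp_wheelGraph_add :
    numComp (wheelGraph (k + 3)) + (k + 3) =
      Nat.card {σ : Fin (k + 3) → Fin 3 // AvoidsZeroOne σ} := by
  classical
  have h := card_hasUniqueCut (k := k)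
  rw [numComp_wheelGraph_eq_card_label]
  simp only [Nat.card_eq_fintype_card, Fintype.card_subtype, ← Finset.filter_filter] at h ⊢
  have h' := Finset.card_filter_add_card_filter_not
    (s := Finset.univ.filter (AvoidsZeroOne (k := k))) HasUniqueCut
  rw [h, add_comm] at h'
  convert h'

end Wheel

section TransferMatrix

open Matrix

/-- Powers of a matrix as sums over walks. -/
theorem pow_mulVec_eq_sum_walk {α : Type*} [Fintype α] [DecidableEq α] (M : Matrix α α ℤ)
    (v : α → ℤ) (k : ℕ) (x : α) :
    ((M ^ k) *ᵥ v) x = ∑ f : Fin k → α,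
      (∏ i : Fin k, M ((Fin.cons x f : Fin (k + 1) → α) i.castSucc) (f i)) *
        v ((Fin.cons x f : Fin (k + 1) → α) (Fin.last k)) := by
  induction k generalizing x with
  | zero => simp
  | succ k ih =>
    rw [pow_succ', ← mulVec_mulVec, mulVec, dotProduct, ← (Fin.consEquiv fun _ => α).sum_comp,
      Fintype.sum_prod_type]
    refine Finset.sum_congr rfl fun z _ => ?_
    rw [ih, Finset.mul_sum]
    refine Finset.sum_congr rfl fun f _ => ?_
    rw [← mul_assoc]
    simp [Fin.consEquiv, Fin.prod_univ_succ, ← Fin.succ_last]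

theorem trace_pow_succ_eq_sum_cyclic {α : Type*} [Fintype α] [DecidableEq α] (M : Matrix α α ℤ)
    (k : ℕ) :
    (M ^ (k + 1)).trace = ∑ f : Fin (k + 1) → α, ∏ i, M (f i) (f (i + 1)) := by
  rw [← (Fin.consEquiv fun _ => α).sum_comp, Fintype.sum_prod_type, trace]
  refine Finset.sum_congr rfl fun x _ => ?_
  have h : (M ^ (k + 1)).diag x = ((M ^ k) *ᵥ fun y => M y x) x := by
    rw [pow_succ]
    rfl
  rw [h, pow_mulVec_eq_sum_walk]
  refine Finset.sum_congr rfl fun f _ => ?_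
  rw [Fin.prod_univ_castSucc]
  simp [Fin.consEquiv]

/-- The transfer matrix of the words over `{0, 1, 2}` in which `0` is never followed by `1`. -/
def avoidMatrix : Matrix (Fin 3) (Fin 3) ℤ := !![1, 0, 1; 1, 1, 1; 1, 1, 1]

theorem card_avoidsZeroOne (k : ℕ) :
    (Nat.card {σ : Fin (k + 3) → Fin 3 // AvoidsZeroOne σ} : ℤ) =
      (avoidMatrix ^ (k + 3)).trace := by
  classical
  have hM : ∀ a b, avoidMatrix a b = if ¬ (a = 0 ∧ b = 1) then 1 else 0 := by
    intro a b
    fin_cases a <;> fin_cases b <;> simp [avoidMatrix]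
  rw [trace_pow_succ_eq_sum_cyclic, Nat.card_eq_fintype_card, Fintype.card_subtype,
    Finset.card_filter, Nat.cast_sum]
  refine Finset.sum_congr rfl fun σ _ => ?_
  simp only [hM, Finset.prod_ite_zero, Finset.prod_const_one, Finset.mem_univ, true_imp_iff]
  have h : AvoidsZeroOne σ ↔ ∀ i, ¬ (σ i = 0 ∧ σ (i + 1) = 1) :=
    ⟨fun h i => by simpa using h (i + 1), fun h i => by simpa using h (i - 1)⟩
  simp only [h]
  split_ifs <;> simp

theorem trace_avoidMatrix_pow_add_three (k : ℕ) :
    (avoidMatrix ^ (k + 3)).trace =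
      3 * (avoidMatrix ^ (k + 2)).trace - (avoidMatrix ^ (k + 1)).trace := by
  have h : avoidMatrix ^ 3 = (3 : ℤ) • avoidMatrix ^ 2 - avoidMatrix := by decide
  rw [pow_add, h, mul_sub, mul_smul_comm, ← pow_add, ← pow_succ, trace_sub, trace_smul, smul_eq_mul]

end TransferMatrix

section Words

/-- The concatenation of `e` copies of the list `c`. -/
def listPow {α : Type*} (c : List α) (e : ℕ) : List α := (List.replicate e c).flatten

variable {α : Type*}

@[simp] theorem listPow_zero (c : List α) : listPow c 0 = [] := rfl

theorem listPow_succ (c : List α) (e : ℕ) : listPow c (e + 1) = c ++ listPow c e := rfl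

@[simp] theorem length_listPow (c : List α) (e : ℕ) :
    (listPow c e).length = e * c.length := by
  simp [listPow]

theorem mem_of_mem_listPow {c : List α} {e : ℕ} {x : α} (h : x ∈ listPow c e) : x ∈ c := by
  induction e with
  | zero => simp at h
  | succ e ih =>
    rw [listPow_succ, List.mem_append] at h
    exact h.elim id ih

theorem listPow_cons_append (a : α) (t : List α) (e : ℕ) :
    listPow (a :: t) e ++ [a] = a :: listPow (t ++ [a]) e := by
  induction e with
  | zero => rfl
  | succ e ih => rw [listPow_succ, List.append_assoc, ih, listPow_succ]; simp

theorem rotate_listPow (c : List α) (e k : ℕ) :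
    (listPow c e).rotate k = listPow (c.rotate k) e := by
  induction k with
  | zero => simp
  | succ k ih =>
    rw [← List.rotate_rotate, ih, ← List.rotate_rotate]
    generalize c.rotate k = d
    cases d with
    | nil => simp [listPow]
    | cons a t =>
      cases e with
      | zero => rfl
      | succ e =>
        rw [listPow_succ, List.cons_append, List.rotate_cons_succ, List.rotate_zero,
          List.rotate_cons_succ, List.rotate_zero, List.append_assoc, listPow_cons_append,
          listPow_succ]
        simp

theorem listPow_injective_of_length_eq {c d : List α} {e : ℕ} (he : 0 < e)
    (hlen : c.length = d.length) (h : listPow c e = listPow d e) : c = d := by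
  obtain ⟨e, rfl⟩ := Nat.exists_eq_add_one.2 he
  exact (List.append_inj h hlen).1

theorem eq_listPow_of_append_comm (u : List α) (e : ℕ) {v : List α}
    (hlen : v.length = e * u.length) (h : u ++ v = v ++ u) : v = listPow u e := by
  induction e generalizing v with
  | zero => exact List.eq_nil_of_length_eq_zero (by simpa using hlen)
  | succ e ih =>
    have hle : u.length ≤ v.length := by rw [hlen]; exact Nat.le_mul_of_pos_left _ (by omega)
    obtain ⟨w, rfl⟩ : u <+: v :=
      List.prefix_of_prefix_length_le ⟨v, rfl⟩ ⟨u, h.symm⟩ hle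
    rw [listPow_succ, ih (v := w)]
    · rw [List.length_append] at hlen
      linarith
    · rw [List.append_assoc] at h
      exact List.append_cancel_left h

theorem eq_listPow_of_rotate_eq {l : List α} {p : ℕ} (hp : 0 < p) (hdvd : p ∣ l.length)
    (h : l.rotate p = l) : l = listPow (l.take p) (l.length / p) := by
  rcases Nat.eq_zero_or_pos l.length with h0 | hpos
  · simp [List.eq_nil_of_length_eq_zero h0]
  have hle := Nat.le_of_dvd hpos hdvd
  obtain ⟨e, he⟩ := hdvd
  rw [he, Nat.mul_div_cancel_left _ hp]
  have htake : (l.take p).length = p := by simpa using hle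
  obtain ⟨e, rfl⟩ : ∃ e', e = e' + 1 := Nat.exists_eq_add_one.2 (by
    by_contra h0
    simp_all)
  rw [List.rotate_eq_drop_append_take hle] at h
  have hdrop := eq_listPow_of_append_comm (l.take p) e (v := l.drop p)
    (by rw [List.length_drop, htake, he, mul_add, mul_one, Nat.add_sub_cancel, mul_comm])
    (by rw [h, List.take_append_drop])
  conv_lhs => rw [← List.take_append_drop p l, hdrop]
  rw [listPow_succ]

/-- The least positive `p` such that rotating `l` by `p` leaves it unchanged. -/
noncomputable def rotPeriod (l : List α) : ℕ :=
  Function.minimalPeriod (fun l : List α => l.rotate 1) l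

theorem iterate_rotate_one (l : List α) (k : ℕ) :
    (fun l : List α => l.rotate 1)^[k] l = l.rotate k := by
  induction k with
  | zero => simp
  | succ k ih => rw [Function.iterate_succ_apply', ih, List.rotate_rotate]

theorem isPeriodicPt_rotate_iff {l : List α} {k : ℕ} :
    Function.IsPeriodicPt (fun l : List α => l.rotate 1) k l ↔ l.rotate k = l := by
  rw [Function.IsPeriodicPt, Function.IsFixedPt, iterate_rotate_one]

theorem rotPeriod_dvd {l : List α} {k : ℕ} (h : l.rotate k = l) : rotPeriod l ∣ k :=
  (isPeriodicPt_rotate_iff.2 h).minimalPeriod_dvd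

theorem rotPeriod_dvd_length (l : List α) : rotPeriod l ∣ l.length :=
  rotPeriod_dvd l.rotate_length

theorem rotate_rotPeriod (l : List α) : l.rotate (rotPeriod l) = l :=
  isPeriodicPt_rotate_iff.1 (Function.isPeriodicPt_minimalPeriod _ l)

theorem rotPeriod_pos {l : List α} (hl : l ≠ []) : 0 < rotPeriod l :=
  Nat.pos_of_dvd_of_pos (rotPeriod_dvd_length l) (List.length_pos_iff.2 hl)

theorem rotate_injOn_rotPeriod {l : List α} {i j : ℕ} (hi : i < rotPeriod l)
    (hj : j < rotPeriod l) (h : l.rotate i = l.rotate j) : i = j :=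
  Function.iterate_injOn_Iio_minimalPeriod (f := fun l : List α => l.rotate 1) hi hj
    (by simpa only [iterate_rotate_one] using h)

theorem rotPeriod_listPow {c : List α} {e : ℕ} (he : 0 < e) :
    rotPeriod (listPow c e) = rotPeriod c := by
  refine Nat.dvd_antisymm (rotPeriod_dvd ?_) (rotPeriod_dvd ?_)
  · rw [rotate_listPow, rotate_rotPeriod]
  · refine listPow_injective_of_length_eq he (by simp) ?_
    rw [← rotate_listPow, rotate_rotPeriod]

/-- A list that is not a proper power. -/
def IsAperiodic (l : List α) : Prop :=
  ¬ ∃ (p : List α) (m : ℕ), 2 ≤ m ∧ l = (List.replicate m p).flatten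

theorem IsAperiodic.rotPeriod_eq {l : List α} (hl : IsAperiodic l) (hne : l ≠ []) :
    rotPeriod l = l.length := by
  obtain ⟨m, hm⟩ := rotPeriod_dvd_length l
  have hp := rotPeriod_pos hne
  have hpow := eq_listPow_of_rotate_eq hp ⟨m, hm⟩ (rotate_rotPeriod l)
  rw [hm, Nat.mul_div_cancel_left _ hp] at hpow
  have h2 : ¬ 2 ≤ m := fun h => hl ⟨_, m, h, hpow⟩
  have h0 : m ≠ 0 := fun h => hne (by rw [hpow, h, listPow_zero])
  obtain rfl : m = 1 := by omega
  omega

theorem isAperiodic_of_rotPeriod_eq {l : List α} (hne : l ≠ []) (h : rotPeriod l = l.length) :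
    IsAperiodic l := by
  rintro ⟨p, m, hm, hl⟩
  change l = listPow p m at hl
  have hdvd := rotPeriod_dvd_length p
  have hlen : l.length = m * p.length := by rw [hl, length_listPow]
  rw [hlen, hl, rotPeriod_listPow (by omega)] at h
  have hp : 0 < p.length := Nat.pos_of_ne_zero fun h0 =>
    hne (List.eq_nil_of_length_eq_zero (by rw [hlen, h0, mul_zero]))
  have := Nat.le_of_dvd hp hdvd
  nlinarith

theorem IsAperiodic.rotate {l : List α} (hl : IsAperiodic l) (k : ℕ) :
    IsAperiodic (l.rotate k) := by
  rintro ⟨p, m, hm, h⟩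
  obtain ⟨j, hj⟩ : ∃ j, (l.rotate k).rotate j = l :=
    (List.isRotated_comm.1 ⟨k, rfl⟩ : (l.rotate k).IsRotated l)
  refine hl ⟨p.rotate j, m, hm, ?_⟩
  rw [← hj, h]
  exact rotate_listPow p m j

theorem exists_listPow_isAperiodic {l : List α} (hl : l ≠ []) :
    ∃ c e, IsAperiodic c ∧ l = listPow c e := by
  have hp := rotPeriod_pos hl
  have hdvd := rotPeriod_dvd_length l
  have hle := Nat.le_of_dvd (List.length_pos_iff.2 hl) hdvd
  have hpow := eq_listPow_of_rotate_eq hp hdvd (rotate_rotPeriod l)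
  have htake : (l.take (rotPeriod l)).length = rotPeriod l := by simpa using hle
  refine ⟨_, _, isAperiodic_of_rotPeriod_eq ?_ ?_, hpow⟩
  · exact List.length_pos_iff.1 (htake.symm ▸ hp)
  · rw [htake, ← rotPeriod_listPow (Nat.div_pos hle hp), ← hpow]

theorem exists_rotate_le_s11 [LinearOrder α] (c : List α) :
    ∃ k, ∀ j, c.rotate k ≤ (c.rotate k).rotate j := by
  obtain ⟨k, -, hk⟩ := Finset.exists_min_image (Finset.range (c.length + 1)) (fun k => c.rotate k)
    ⟨0, by simp⟩
  refine ⟨k, fun j => ?_⟩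
  rw [List.rotate_rotate, ← List.rotate_mod c (k + j)]
  rcases Nat.eq_zero_or_pos c.length with h0 | hpos
  · simp [List.eq_nil_of_length_eq_zero h0]
  · exact hk _ (Finset.mem_range.2 ((Nat.mod_lt _ hpos).trans (Nat.lt_succ_self _)))

theorem eq_of_isRotated_of_le [LinearOrder α] {c d : List α} (hc : ∀ k, c ≤ c.rotate k)
    (hd : ∀ k, d ≤ d.rotate k) (h : c ~r d) : c = d := by
  obtain ⟨j, hj⟩ := h.symm
  obtain ⟨i, hi⟩ := h
  exact le_antisymm (hi ▸ hc i) (hj ▸ hd j)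

theorem sum_headI_rotate (c : List ℕ) :
    ∑ k ∈ Finset.range c.length, (c.rotate k).headI = c.sum := by
  rw [← Fin.sum_univ_getElem, Finset.sum_range]
  refine Finset.sum_congr rfl fun k _ => ?_
  have h := List.head?_rotate k.isLt
  rw [List.getElem?_eq_getElem k.isLt] at h
  cases hc : c.rotate k with
  | nil => simp [hc] at h
  | cons a t => simpa [hc] using h

end Words

section LyndonSum

open Finset.HasAntidiagonal (antidiagonal)

open scoped Classical in
/-- The lists of positive integers with sum `m`. -/
noncomputable def compLists (m : ℕ) : Finset (List ℕ) :=
  (Finset.univ : Finset (Composition m)).image Composition.blocks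

theorem mem_compLists {m : ℕ} {l : List ℕ} :
    l ∈ compLists m ↔ (∀ i ∈ l, 0 < i) ∧ l.sum = m := by
  simp only [compLists, Finset.mem_image, Finset.mem_univ, true_and]
  constructor
  · rintro ⟨c, rfl⟩
    exact ⟨fun _ h => c.blocks_pos h, c.blocks_sum⟩
  · rintro ⟨h, h'⟩
    exact ⟨⟨l, fun hi => h _ hi, h'⟩, rfl⟩

open scoped Classical in
theorem sum_filter_composition (m : ℕ) (p : List ℕ → Prop) (g : List ℕ → ℕ) :
    ∑ c ∈ Finset.univ.filter (fun c : Composition m => p c.blocks), g c.blocks =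
      ∑ l ∈ (compLists m).filter p, g l := by
  rw [compLists, Finset.filter_image, Finset.sum_image]
  exact fun _ _ _ _ h => Composition.ext h

theorem ne_nil_of_mem_compLists {m : ℕ} (hm : 0 < m) {l : List ℕ} (h : l ∈ compLists m) :
    l ≠ [] := by
  rintro rfl
  have := (mem_compLists.1 h).2
  simp at this
  omega

theorem sum_listPow (c : List ℕ) (e : ℕ) : (listPow c e).sum = e * c.sum := by
  induction e with
  | zero => simp
  | succ e ih => rw [listPow_succ, List.sum_append, ih]; ring

theorem prod_map_listPow (f : ℕ → ℕ) (c : List ℕ) (e : ℕ) :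
    ((listPow c e).map f).prod = (c.map fun a => f a ^ e).prod := by
  have hpow : (c.map fun a => f a ^ e).prod = (c.map f).prod ^ e := by
    induction c with
    | nil => simp
    | cons a t ih => simp [ih, mul_pow]
  rw [hpow]
  clear hpow
  induction e with
  | zero => simp
  | succ e ih => rw [listPow_succ, List.map_append, List.prod_append, ih, pow_succ']

theorem headI_listPow {c : List ℕ} {e : ℕ} (he : 0 < e) (hc : c ≠ []) :
    (listPow c e).headI = c.headI := by
  obtain ⟨e, rfl⟩ := Nat.exists_eq_add_one.2 he
  obtain ⟨a, t, rfl⟩ := List.exists_cons_of_ne_nil hc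
  rfl

theorem rotate_mem_compLists {m : ℕ} {l : List ℕ} (h : l ∈ compLists m) (k : ℕ) :
    l.rotate k ∈ compLists m := by
  rw [mem_compLists] at h ⊢
  exact ⟨fun i hi => h.1 i (List.mem_rotate.1 hi), by rw [(l.rotate_perm k).sum_eq, h.2]⟩

open scoped Classical in
/-- Compositions of `m` weighted by their first part, grouped by the Lyndon rotation of their
primitive root. -/
theorem sum_headI_mul_prod_eq_sum_lyndon (f : ℕ → ℕ) {m : ℕ} (hm : 0 < m) :
    ∑ l ∈ compLists m, l.headI * (l.map f).prod =
      ∑ d ∈ m.divisors, d * ∑ c ∈ (compLists d).filter IsLyndonComposition,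
        (c.map fun a => f a ^ (m / d)).prod := by
  have hexp : ∀ d ∈ m.divisors, d * ∑ c ∈ (compLists d).filter IsLyndonComposition,
        (c.map fun a => f a ^ (m / d)).prod =
      ∑ c ∈ (compLists d).filter IsLyndonComposition, ∑ k ∈ Finset.range c.length,
        (c.rotate k).headI * (c.map fun a => f a ^ (m / d)).prod := by
    intro d _
    rw [Finset.mul_sum]
    refine Finset.sum_congr rfl fun c hc => ?_
    rw [← Finset.sum_mul, sum_headI_rotate, (mem_compLists.1 (Finset.mem_filter.1 hc).1).2]
  have hdiv : ∀ d ∈ m.divisors, 0 < d ∧ 0 < m / d ∧ m / d * d = m := by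
    intro d hd
    have hdm := Nat.dvd_of_mem_divisors hd
    have hd0 := Nat.pos_of_mem_divisors hd
    exact ⟨hd0, Nat.div_pos (Nat.le_of_dvd hm hdm) hd0, Nat.div_mul_cancel hdm⟩
  rw [Finset.sum_congr rfl hexp]
  simp only [Finset.sum_sigma']
  symm
  refine Finset.sum_bij (fun x _ => (listPow x.2.1 (m / x.1)).rotate x.2.2) ?_ ?_ ?_ ?_
  · rintro ⟨d, c, k⟩ h
    simp only [Finset.mem_sigma, Finset.mem_filter, Finset.mem_range] at h
    obtain ⟨hd, ⟨hc, -⟩, -⟩ := h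
    obtain ⟨-, -, he⟩ := hdiv d hd
    refine rotate_mem_compLists ?_ k
    rw [mem_compLists] at hc ⊢
    exact ⟨fun i hi => hc.1 i (mem_of_mem_listPow hi), by rw [sum_listPow, hc.2, he]⟩
  · rintro ⟨d, c, k⟩ h ⟨d', c', k'⟩ h' heq
    simp only [Finset.mem_sigma, Finset.mem_filter, Finset.mem_range] at h h' heq
    obtain ⟨hd, ⟨hc, hcL⟩, hk⟩ := h
    obtain ⟨hd', ⟨hc', hcL'⟩, hk'⟩ := h'
    obtain ⟨hd0, he0, he⟩ := hdiv d hd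
    obtain ⟨hd0', he0', he'⟩ := hdiv d' hd'
    have hp := IsAperiodic.rotPeriod_eq hcL.1 (ne_nil_of_mem_compLists hd0 hc)
    have hp' := IsAperiodic.rotPeriod_eq hcL'.1 (ne_nil_of_mem_compLists hd0' hc')
    rw [rotate_listPow, rotate_listPow] at heq
    have hlen : c.length = c'.length := by
      have h1 := IsAperiodic.rotPeriod_eq (IsAperiodic.rotate hcL.1 k)
        (by simpa using ne_nil_of_mem_compLists hd0 hc)
      have h2 := IsAperiodic.rotPeriod_eq (IsAperiodic.rotate hcL'.1 k')
        (by simpa using ne_nil_of_mem_compLists hd0' hc')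
      rw [← rotPeriod_listPow he0, heq, rotPeriod_listPow he0', h2] at h1
      simpa using h1.symm
    have hpos : 0 < c.length := by omega
    have hee : m / d = m / d' := by
      have := congrArg List.length heq
      simp only [length_listPow, List.length_rotate, ← hlen] at this
      exact Nat.eq_of_mul_eq_mul_right hpos this
    have hrot : c.rotate k = c'.rotate k' := by
      rw [← hee] at heq
      exact listPow_injective_of_length_eq he0 (by simpa using hlen) heq
    have hcc : c = c' := eq_of_isRotated_of_le hcL.2 hcL'.2
      (List.IsRotated.trans ⟨k, hrot⟩ (List.IsRotated.symm ⟨k', rfl⟩))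
    subst hcc
    obtain rfl : d = d' := (mem_compLists.1 hc).2.symm.trans (mem_compLists.1 hc').2
    obtain rfl := rotate_injOn_rotPeriod (hp ▸ hk) (hp ▸ hk') hrot
    rfl
  · intro l hl
    obtain ⟨r, e, hr, rfl⟩ := exists_listPow_isAperiodic (ne_nil_of_mem_compLists hm hl)
    obtain ⟨j, hj⟩ := exists_rotate_le_s11 r
    obtain ⟨i, hi⟩ : r.rotate j ~r r := List.IsRotated.symm ⟨j, rfl⟩
    have he : e ≠ 0 := by
      rintro rfl
      exact ne_nil_of_mem_compLists hm hl rfl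
    have hr0 : 0 < r.length := List.length_pos_iff.2 (by
      rintro rfl
      exact ne_nil_of_mem_compLists hm hl (by simp [listPow]))
    obtain ⟨hlpos, hlsum⟩ := mem_compLists.1 hl
    rw [sum_listPow] at hlsum
    have hmem : r ∈ compLists r.sum := by
      refine mem_compLists.2 ⟨fun x hx => hlpos x ?_, rfl⟩
      obtain ⟨e, rfl⟩ := Nat.exists_eq_succ_of_ne_zero he
      rw [listPow_succ]
      exact List.mem_append_left _ hx
    have hsum : 0 < r.sum := by
      by_contra h0
      simp_all
    refine ⟨⟨r.sum, r.rotate j, i % r.length⟩, ?_, ?_⟩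
    · simp only [Finset.mem_sigma, Finset.mem_filter, Finset.mem_range, Nat.mem_divisors]
      exact ⟨⟨⟨e, by rw [← hlsum, mul_comm]⟩, hm.ne'⟩,
        ⟨rotate_mem_compLists hmem j, IsAperiodic.rotate hr j, hj⟩,
        by simpa using Nat.mod_lt _ hr0⟩
    · have hme : m / r.sum = e := by rw [← hlsum, Nat.mul_div_cancel _ hsum]
      have hmod : (r.rotate j).rotate (i % r.length) = r := by
        rw [← List.length_rotate (l := r) (n := j), List.rotate_mod, hi]
      simp only [rotate_listPow, hme, hmod]
  · rintro ⟨d, c, k⟩ h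
    simp only [Finset.mem_sigma, Finset.mem_filter, Finset.mem_range] at h ⊢
    obtain ⟨hd, ⟨hc, -⟩, -⟩ := h
    obtain ⟨hd0, he0, -⟩ := hdiv d hd
    rw [((List.rotate_perm _ k).map f).prod_eq, prod_map_listPow, rotate_listPow,
      headI_listPow he0 (by simpa using ne_nil_of_mem_compLists hd0 hc)]

theorem sum_compLists_succ (m : ℕ) (g : List ℕ → ℕ) :
    ∑ l ∈ compLists (m + 1), g l =
      ∑ x ∈ antidiagonal m, ∑ l ∈ compLists x.2, g ((x.1 + 1) :: l) := by
  rw [Finset.sum_sigma']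
  symm
  refine Finset.sum_bij (fun x _ => (x.1.1 + 1) :: x.2) ?_ ?_ ?_ fun _ _ => rfl
  · rintro ⟨⟨a, b⟩, l⟩ h
    simp only [Finset.mem_sigma, Finset.HasAntidiagonal.mem_antidiagonal, mem_compLists] at h ⊢
    refine ⟨?_, by rw [List.sum_cons, h.2.2]; omega⟩
    rintro i (_ | ⟨_, hi⟩)
    · omega
    · exact h.2.1 i hi
  · rintro ⟨⟨a, b⟩, l⟩ h ⟨⟨a', b'⟩, l'⟩ h' heq
    simp only [Finset.mem_sigma, Finset.HasAntidiagonal.mem_antidiagonal, mem_compLists,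
      List.cons.injEq] at h h' heq
    obtain ⟨h1, rfl⟩ := heq
    obtain rfl : a = a' := by omega
    obtain rfl : b = b' := by omega
    rfl
  · intro l h
    cases l with
    | nil => exact absurd rfl (ne_nil_of_mem_compLists (Nat.succ_pos m) h)
    | cons a t =>
      obtain ⟨hpos, hsum⟩ := mem_compLists.1 h
      have ha := hpos a List.mem_cons_self
      rw [List.sum_cons] at hsum
      refine ⟨⟨(a - 1, t.sum), t⟩, ?_, ?_⟩
      · simp only [Finset.mem_sigma, Finset.HasAntidiagonal.mem_antidiagonal, mem_compLists]
        exact ⟨by omega, fun i hi => hpos i (List.mem_cons_of_mem _ hi), trivial⟩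
      · simp only [List.cons.injEq, and_true]
        omega

theorem compLists_zero : compLists 0 = {[]} := by
  ext l
  rw [mem_compLists, Finset.mem_singleton]
  constructor
  · rintro ⟨hpos, hsum⟩
    cases l with
    | nil => rfl
    | cons a t =>
      have := hpos a List.mem_cons_self
      rw [List.sum_cons] at hsum
      omega
  · rintro rfl
    simp

theorem compLists_one : compLists 1 = {[1]} := by
  ext l
  rw [mem_compLists, Finset.mem_singleton]
  constructor
  · rintro ⟨hpos, hsum⟩
    cases l with
    | nil => simp at hsum
    | cons a t =>
      have ha := hpos a List.mem_cons_self
      rw [List.sum_cons] at hsum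
      have ht : t ∈ compLists 0 :=
        mem_compLists.2 ⟨fun i hi => hpos i (List.mem_cons_of_mem _ hi), by omega⟩
      rw [compLists_zero, Finset.mem_singleton] at ht
      rw [ht, show a = 1 by omega]
  · rintro rfl
    simp

theorem isLyndonComposition_singleton (a : ℕ) : IsLyndonComposition [a] := by
  refine ⟨?_, fun k => by simp⟩
  refine isAperiodic_of_rotPeriod_eq (by simp) ?_
  have h := rotPeriod_dvd_length [a]
  simpa using h

end LyndonSum

section Count

open Finset.HasAntidiagonal (antidiagonal)

/-- The number of compositions of the path on `a - 1` vertices. -/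
noncomputable def pathWeight (a : ℕ) : ℕ := numComp (SimpleGraph.pathGraph (a - 1))

theorem pathWeight_one : pathWeight 1 = 1 := numComp_pathGraph_zero

theorem pathWeight_add_two (a : ℕ) : pathWeight (a + 2) = 2 ^ a := numComp_pathGraph_succ a

/-- The total path weight of the compositions of `m`. -/
noncomputable def totalWeight (m : ℕ) : ℕ := ∑ l ∈ compLists m, (l.map pathWeight).prod

/-- The total path weight of the compositions of `m`, each multiplied by its first part. -/
noncomputable def markedWeight (m : ℕ) : ℕ :=
  ∑ l ∈ compLists m, l.headI * (l.map pathWeight).prod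

theorem totalWeight_zero : totalWeight 0 = 1 := by simp [totalWeight, compLists_zero]

theorem totalWeight_one : totalWeight 1 = 1 := by
  simp [totalWeight, compLists_one, pathWeight_one]

theorem markedWeight_one : markedWeight 1 = 1 := by
  simp [markedWeight, compLists_one, pathWeight_one]

theorem totalWeight_succ (m : ℕ) :
    totalWeight (m + 1) =
      ∑ x ∈ antidiagonal m, pathWeight (x.1 + 1) * totalWeight x.2 := by
  rw [totalWeight, sum_compLists_succ]
  simp [totalWeight, Finset.mul_sum]

theorem markedWeight_succ (m : ℕ) :
    markedWeight (m + 1) =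
      ∑ x ∈ antidiagonal m, (x.1 + 1) * pathWeight (x.1 + 1) * totalWeight x.2 := by
  rw [markedWeight, sum_compLists_succ]
  simp [totalWeight, Finset.mul_sum, mul_assoc]

theorem pathWeight_succ_succ (a : ℕ) :
    pathWeight (a + 2) + (if a = 0 then 1 else 0) = 2 * pathWeight (a + 1) := by
  cases a with
  | zero => simp [pathWeight_one, pathWeight_add_two 0]
  | succ a => simp [pathWeight_add_two, pow_succ']

theorem sum_antidiagonal_ite_fst_eq_zero (m : ℕ) (g : ℕ → ℕ) :
    ∑ x ∈ antidiagonal m, (if x.1 = 0 then 1 else 0) * g x.2 = g m := by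
  rw [Finset.Nat.sum_antidiagonal_eq_sum_range_succ
    (fun i j => (if i = 0 then 1 else 0) * g j)]
  simp

theorem totalWeight_add_two (m : ℕ) :
    totalWeight (m + 2) + totalWeight m = 3 * totalWeight (m + 1) := by
  have h : ∑ x ∈ antidiagonal m, pathWeight (x.1 + 2) * totalWeight x.2 + totalWeight m =
      2 * totalWeight (m + 1) := by
    conv_lhs => rw [← sum_antidiagonal_ite_fst_eq_zero m totalWeight]
    rw [← Finset.sum_add_distrib, totalWeight_succ, Finset.mul_sum]
    refine Finset.sum_congr rfl fun x _ => ?_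
    rw [← add_mul, pathWeight_succ_succ, mul_assoc]
  rw [totalWeight_succ (m + 1), Finset.Nat.antidiagonal_succ, Finset.sum_cons, Finset.sum_map]
  simp only [Function.Embedding.prodMap, Function.Embedding.coeFn_mk, Prod.map,
    Function.Embedding.refl_apply, Nat.succ_eq_add_one, zero_add, pathWeight_one]
  linarith

theorem markedWeight_add_two (m : ℕ) :
    markedWeight (m + 2) + 2 * totalWeight m =
      2 * markedWeight (m + 1) + 3 * totalWeight (m + 1) := by
  have h : ∑ x ∈ antidiagonal m, (x.1 + 2) * pathWeight (x.1 + 2) * totalWeight x.2 +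
      2 * totalWeight m = 2 * markedWeight (m + 1) + 2 * totalWeight (m + 1) := by
    conv_lhs => rw [← sum_antidiagonal_ite_fst_eq_zero m totalWeight]
    rw [Finset.mul_sum, ← Finset.sum_add_distrib, markedWeight_succ, totalWeight_succ,
      Finset.mul_sum, Finset.mul_sum, ← Finset.sum_add_distrib]
    refine Finset.sum_congr rfl fun x _ => ?_
    have h1 : (x.1 + 2) * pathWeight (x.1 + 2) + 2 * (if x.1 = 0 then 1 else 0) =
        2 * ((x.1 + 1) * pathWeight (x.1 + 1)) + 2 * pathWeight (x.1 + 1) := by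
      have h2 := pathWeight_succ_succ x.1
      split_ifs at h2 ⊢ with h0
      · rw [h0] at h2 ⊢
        linarith
      · linear_combination (x.1 + 2) * h2
    linear_combination totalWeight x.2 * h1
  rw [markedWeight_succ (m + 1), Finset.Nat.antidiagonal_succ, Finset.sum_cons, Finset.sum_map]
  simp only [Function.Embedding.prodMap, Function.Embedding.coeFn_mk, Prod.map,
    Function.Embedding.refl_apply, Nat.succ_eq_add_one, zero_add, pathWeight_one, add_assoc,
    Nat.reduceAdd, one_mul]
  linarith

theorem trace_avoidMatrix_pow_add_two (m : ℕ) :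
    (avoidMatrix ^ (m + 2)).trace =
      2 * (avoidMatrix ^ (m + 1)).trace + 3 * (totalWeight (m + 1) : ℤ) - 2 * totalWeight m := by
  induction m using Nat.twoStepInduction with
  | zero =>
    rw [totalWeight_zero, totalWeight_one]
    decide
  | one =>
    have h := totalWeight_add_two 0
    rw [totalWeight_zero, totalWeight_one] at h
    rw [totalWeight_one, show totalWeight (1 + 1) = 2 by linarith]
    decide
  | more m ih1 ih2 =>
    have h1 : (totalWeight (m + 2) + totalWeight m : ℤ) = 3 * totalWeight (m + 1) := by
      exact_mod_cast totalWeight_add_two m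
    have h2 : (totalWeight (m + 3) + totalWeight (m + 1) : ℤ) = 3 * totalWeight (m + 2) := by
      exact_mod_cast totalWeight_add_two (m + 1)
    have h3 := trace_avoidMatrix_pow_add_three m
    have h4 := trace_avoidMatrix_pow_add_three (m + 1)
    simp only [add_assoc, Nat.reduceAdd] at *
    linarith

theorem trace_avoidMatrix_pow_succ (m : ℕ) :
    (avoidMatrix ^ (m + 1)).trace = (markedWeight (m + 1) : ℤ) + 2 ^ (m + 1) := by
  induction m with
  | zero =>
    rw [markedWeight_one]
    decide
  | succ m ih =>
    have h : (markedWeight (m + 2) + 2 * totalWeight m : ℤ) =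
        2 * markedWeight (m + 1) + 3 * totalWeight (m + 1) := by
      exact_mod_cast markedWeight_add_two m
    rw [trace_avoidMatrix_pow_add_two, ih, pow_succ 2 (m + 1)]
    linarith

theorem numComp_wheelGraph_add_eq (k : ℕ) :
    numComp (wheelGraph (k + 3)) + (k + 3) = markedWeight (k + 3) + 2 ^ (k + 3) := by
  rw [numComp_wheelGraph_add]
  have h := card_avoidsZeroOne k
  rw [trace_avoidMatrix_pow_succ] at h
  exact_mod_cast h

end Count

open scoped Classical in
/-- For `n ≥ 4`, the number of compositions of the wheel graph `W_n` on `n` vertices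
(`n - 1` outer vertices) is
`2^(n−1) − n + 2 + Σ_{d ∣ n−1, d>1} d · Σ'_{(a_1,…,a_k)} Π_i C(P_{a_i−1})^{(n−1)/d}`,
where the inner sum ranges over Lyndon compositions of `d`. -/
theorem numComp_wheelGraph (n : ℕ) (hn : 4 ≤ n) :
    numComp (wheelGraph (n - 1)) =
      2 ^ (n - 1) - n + 2 +
        ∑ d ∈ (n - 1).divisors.filter (fun d => 1 < d),
          d * ∑ c ∈ Finset.univ.filter
              (fun c : Composition d => IsLyndonComposition c.blocks),
            (c.blocks.map
              (fun a => numComp (SimpleGraph.pathGraph (a - 1)) ^ ((n - 1) / d))).prod := by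
  obtain ⟨k, rfl⟩ := Nat.exists_eq_add_of_le' hn
  have hcount := numComp_wheelGraph_add_eq k
  have hlyndon : markedWeight (k + 3) = _ :=
    sum_headI_mul_prod_eq_sum_lyndon pathWeight (Nat.succ_pos (k + 2))
  have hsplit : (k + 3).divisors = insert 1 ((k + 3).divisors.filter fun d => 1 < d) := by
    ext d
    simp only [Finset.mem_insert, Finset.mem_filter, Nat.mem_divisors]
    constructor
    · rintro ⟨h, h'⟩
      have := Nat.pos_of_dvd_of_pos h (Nat.succ_pos _)
      by_cases hd : d = 1
      · exact Or.inl hd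
      · exact Or.inr ⟨⟨h, h'⟩, by omega⟩
    · rintro (rfl | h)
      · exact ⟨one_dvd _, by omega⟩
      · exact h.1
  rw [hsplit, Finset.sum_insert (by simp), compLists_one, Finset.filter_singleton,
    if_pos (isLyndonComposition_singleton 1)] at hlyndon
  simp only [Finset.sum_singleton, List.map_cons, List.map_nil, List.prod_singleton,
    pathWeight_one, one_pow, mul_one] at hlyndon
  have hpow : k + 3 < 2 ^ (k + 3) := Nat.lt_two_pow_self
  have hsum : ∀ d, ∑ c ∈ Finset.univ.filter
      (fun c : Composition d => IsLyndonComposition c.blocks),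
        (c.blocks.map (fun a => numComp (SimpleGraph.pathGraph (a - 1)) ^ ((k + 3) / d))).prod =
      ∑ c ∈ (compLists d).filter IsLyndonComposition,
        (c.map fun a => pathWeight a ^ ((k + 3) / d)).prod := fun d =>
    sum_filter_composition d IsLyndonComposition
      fun c => (c.map fun a => pathWeight a ^ ((k + 3) / d)).prod
  change numComp (wheelGraph (k + 3)) = 2 ^ (k + 3) - (k + 4) + 2 + ∑ d ∈ (k + 3).divisors.filter
    (fun d => 1 < d), d * ∑ c ∈ Finset.univ.filter
      (fun c : Composition d => IsLyndonComposition c.blocks),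
        (c.blocks.map (fun a => numComp (SimpleGraph.pathGraph (a - 1)) ^ ((k + 3) / d))).prod
  simp only [hsum]
  omega
end

section
/- The numbers of compositions of the ladder graphs satisfy C(L_1) = 2, C(L_2) = 12, and for all n > 2, C(L_n) = 6 · C(L_{n−1}) + C(L_{n−2}). -/
/-- The ladder graph `L_n`: the Cartesian (box) product of a path on `2` vertices with
a path on `n` vertices. -/
def ladderGraph (n : ℕ) : SimpleGraph (Fin 2 × Fin n) :=
  (SimpleGraph.pathGraph 2).boxProd (SimpleGraph.pathGraph n)

namespace SimpleGraph

/-- `H` is a flat of `G` if it is a spanning subgraph containing every edge of `G`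
whose ends it connects. -/
def IsFlat {V : Type*} (G H : SimpleGraph V) : Prop :=
  H ≤ G ∧ ∀ u v, G.Adj u v → H.Reachable u v → H.Adj u v

lemma Reachable.eq_of_adj_imp_eq {V α : Type*} {H : SimpleGraph V} {f : V → α}
    (hf : ∀ u v, H.Adj u v → f u = f v) {u v : V} (h : H.Reachable u v) : f u = f v := by
  obtain ⟨p⟩ := h
  induction p with
  | nil => rfl
  | cons h _ ih => exact (hf _ _ h).trans ih

end SimpleGraph

namespace Finpartition

variable {V : Type*} [Fintype V] [DecidableEq V]

lemma ext_of_part_eq_iff {P Q : Finpartition (Finset.univ : Finset V)}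
    (h : ∀ u v, P.part u = P.part v ↔ Q.part u = Q.part v) : P = Q := by
  have key : ∀ u, P.part u = Q.part u := fun u ↦ by
    ext v
    rw [P.mem_part_iff_part_eq_part (Finset.mem_univ _) (Finset.mem_univ _),
      Q.mem_part_iff_part_eq_part (Finset.mem_univ _) (Finset.mem_univ _), h]
  have parts_le : ∀ {P Q : Finpartition (Finset.univ : Finset V)},
      (∀ u, P.part u = Q.part u) → P.parts ⊆ Q.parts := by
    intro P Q key b hb
    obtain ⟨u, hu⟩ := P.nonempty_of_mem_parts hb
    rw [← P.part_eq_of_mem hb hu, key]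
    exact Q.part_mem.2 (Finset.mem_univ u)
  exact Finpartition.ext ((parts_le key).antisymm (parts_le fun u ↦ (key u).symm))

/-- The edges of `G` lying inside a block of `P`. -/
def innerGraph (P : Finpartition (Finset.univ : Finset V)) (G : SimpleGraph V) :
    SimpleGraph V where
  Adj u v := G.Adj u v ∧ P.part u = P.part v
  symm := ⟨fun _ _ h ↦ ⟨h.1.symm, h.2.symm⟩⟩
  loopless := ⟨fun _ h ↦ G.loopless.irrefl _ h.1⟩

lemma innerGraph_reachable_iff {P : Finpartition (Finset.univ : Finset V)} {G : SimpleGraph V}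
    (hP : ∀ b ∈ P.parts, (G.induce (b : Set V)).Connected) {u v : V} :
    (P.innerGraph G).Reachable u v ↔ P.part u = P.part v := by
  refine ⟨fun h ↦ h.eq_of_adj_imp_eq (f := P.part) fun _ _ (h : _ ∧ _) ↦ h.2, fun h ↦ ?_⟩
  have hu : u ∈ P.part u := P.mem_part (Finset.mem_univ u)
  have hv : v ∈ P.part u := h ▸ P.mem_part (Finset.mem_univ v)
  have hb : P.part u ∈ P.parts := P.part_mem.2 (Finset.mem_univ u)
  let f : G.induce (P.part u : Set V) →g P.innerGraph G :=
    ⟨Subtype.val, fun {x y} hxy ↦ ⟨hxy,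
      (P.part_eq_of_mem hb x.2).trans (P.part_eq_of_mem hb y.2).symm⟩⟩
  exact ((hP _ hb).preconnected ⟨u, hu⟩ ⟨v, hv⟩).map f

end Finpartition

lemma numComp_eq_card_isFlat {V : Type*} [Fintype V] [DecidableEq V] (G : SimpleGraph V) :
    numComp G = Nat.card {H : SimpleGraph V // G.IsFlat H} := by
  classical
  refine Nat.card_congr (Equiv.ofBijective (fun P ↦ ⟨P.1.innerGraph G, fun _ _ h ↦ h.1,
    fun u v h hr ↦ ⟨h, (P.1.innerGraph_reachable_iff P.2).1 hr⟩⟩) ⟨?_, ?_⟩)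
  · rintro ⟨P, hP⟩ ⟨Q, hQ⟩ h
    have h : P.innerGraph G = Q.innerGraph G := congrArg Subtype.val h
    refine Subtype.ext (Finpartition.ext_of_part_eq_iff fun u v ↦ ?_)
    rw [← P.innerGraph_reachable_iff hP, h, Q.innerGraph_reachable_iff hQ]
  · rintro ⟨H, hle, hH⟩
    let P : Finpartition (Finset.univ : Finset V) := Finpartition.ofSetoid H.reachableSetoid
    have hmem : ∀ u v, v ∈ P.part u ↔ H.Reachable u v := fun u v ↦
      Finpartition.mem_part_ofSetoid_iff_rel
    have hpart : ∀ u v, P.part u = P.part v ↔ H.Reachable u v := fun u v ↦ by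
      rw [← P.mem_part_iff_part_eq_part (Finset.mem_univ _) (Finset.mem_univ _), hmem,
        SimpleGraph.reachable_comm]
    have hP : ∀ b ∈ P.parts, (G.induce (b : Set V)).Connected := by
      intro b hb
      obtain ⟨u, hu⟩ := P.nonempty_of_mem_parts hb
      have hbu : (b : Set V) = (H.connectedComponentMk u).supp := by
        ext v
        rw [← P.part_eq_of_mem hb hu, Finset.mem_coe, hmem,
          SimpleGraph.ConnectedComponent.mem_supp_iff, SimpleGraph.ConnectedComponent.eq,
          SimpleGraph.reachable_comm]
      rw [hbu]
      exact (H.connectedComponentMk u).connected_toSimpleGraph.mono fun _ _ h ↦ hle h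
    refine ⟨⟨P, hP⟩, Subtype.ext ?_⟩
    ext u v
    change G.Adj u v ∧ P.part u = P.part v ↔ H.Adj u v
    rw [hpart]
    exact ⟨fun h ↦ hH u v h.1 h.2, fun h ↦ ⟨hle h, h.reachable⟩⟩

/-- A square with rungs `r`, `r'` and horizontal edges `h` does not have exactly three of its
edges selected. -/
def SquareFlat (r : Bool) (h : Bool × Bool) (r' : Bool) : Prop :=
  r.toNat + h.1.toNat + h.2.toNat + r'.toNat ≠ 3

instance (r h r') : Decidable (SquareFlat r h r') := inferInstanceAs (Decidable (_ ≠ _))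

lemma exists_half_cut {r : ℕ → Bool} {h : ℕ → Bool × Bool} (hr : r 0 = false)
    (hs : ∀ k, SquareFlat (r k) (h k) (r (k + 1))) :
    ∃ X Y : ℕ → Bool, X 0 = true ∧ Y 0 = false ∧ ((h 0).1 ≠ (h 0).2 → X 1 = Y 1) ∧
      (∀ k, r k = true → X k = Y k) ∧ (∀ k, (h k).1 = true → X k = X (k + 1)) ∧
      ∀ k, (h k).2 = true → Y k = Y (k + 1) := by
  let step (k : ℕ) (p : Bool × Bool) : Bool × Bool :=
    if p.1 = p.2 then p else
      if (h k).1 = true then (if (h k).2 = true then p else (p.1, p.1)) else (p.2, p.2)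
  let Z : ℕ → Bool × Bool := fun k ↦ Nat.rec (true, false) step k
  have hZ : ∀ k, Z (k + 1) = step k (Z k) := fun _ ↦ rfl
  refine ⟨fun k ↦ (Z k).1, fun k ↦ (Z k).2, rfl, rfl, ?_, ?_, ?_, ?_⟩
  · change _ → (step 0 (true, false)).1 = (step 0 (true, false)).2
    simp only [step]
    generalize h 0 = y
    revert y
    decide
  · intro k
    induction k with
    | zero => simp [hr]
    | succ k ih =>
      have := hs k
      simp only [hZ, step]
      dsimp only at ih
      clear_value Z
      revert this ih
      generalize Z k = z, r k = x, r (k + 1) = x', h k = y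
      revert z x x' y
      decide
  · intro k
    simp only [hZ, step]
    generalize Z k = z, h k = y
    revert z y
    decide
  · intro k
    simp only [hZ, step]
    generalize Z k = z, h k = y
    revert z y
    decide

lemma exists_cut {r : ℕ → Bool} {h : ℕ → Bool × Bool}
    (hs : ∀ k, SquareFlat (r k) (h k) (r (k + 1))) {i : ℕ} (hr : r i = false) :
    ∃ X Y : ℕ → Bool, X i = true ∧ Y i = false ∧ ((h i).1 ≠ (h i).2 → X (i + 1) = Y (i + 1)) ∧
      (∀ j, j + 1 = i → (h j).1 ≠ (h j).2 → X j = Y j) ∧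
      (∀ k, r k = true → X k = Y k) ∧ (∀ k, (h k).1 = true → X k = X (k + 1)) ∧
      ∀ k, (h k).2 = true → Y k = Y (k + 1) := by
  obtain ⟨X, Y, hX, hY, h1, h2, h3, h4⟩ := exists_half_cut (r := fun k ↦ r (i + k))
    (h := fun k ↦ h (i + k)) hr fun k ↦ hs (i + k)
  obtain ⟨X', Y', hX', hY', h1', h2', h3', h4'⟩ := exists_half_cut
    (r := fun k ↦ if k ≤ i then r (i - k) else false)
    (h := fun k ↦ if k < i then h (i - 1 - k) else (false, false)) (by simpa using hr) (by
      intro k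
      rcases lt_trichotomy k i with hk | hk | hk
      · have := hs (i - 1 - k)
        have e : i - 1 - k + 1 = i - k := by omega
        have e' : i - (k + 1) = i - 1 - k := by omega
        rw [e] at this
        simp only [hk, hk.le, Nat.succ_le_of_lt hk, e', if_true]
        unfold SquareFlat at *
        omega
      · have := (r 0).toNat_le
        simp [hk, SquareFlat]
        omega
      · simp [SquareFlat, hk.not_ge, hk.not_gt, show ¬ k + 1 ≤ i by omega])
  refine ⟨fun j ↦ if i ≤ j then X (j - i) else X' (i - j),
    fun j ↦ if i ≤ j then Y (j - i) else Y' (i - j), by simpa, by simpa, ?_, ?_, ?_, ?_, ?_⟩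
  · simpa using h1
  · rintro j rfl
    simpa using h1'
  · intro k hk
    dsimp only
    split_ifs with hik
    · exact h2 _ (by simpa [hik] using hk)
    · exact h2' _ (by simpa [show i - (i - k) = k by omega] using hk)
  · intro k hk
    dsimp only
    rcases lt_trichotomy (k + 1) i with hik | hik | hik
    · have := h3' (i - (k + 1))
      simp only [show i - 1 - (i - (k + 1)) = k by omega, show i - (k + 1) + 1 = i - k by omega,
        show i - (k + 1) < i by omega, if_true] at this
      simp [this hk, show ¬ i ≤ k by omega, show ¬ i ≤ k + 1 by omega]
    · subst hik
      have := h3' 0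
      simp at this
      simp [← this hk, hX, hX']
    · have := h3 (k - i)
      simp only [show i + (k - i) = k by omega, show k - i + 1 = k + 1 - i by omega] at this
      simp [this hk, show i ≤ k by omega, show i ≤ k + 1 by omega]
  · intro k hk
    dsimp only
    rcases lt_trichotomy (k + 1) i with hik | hik | hik
    · have := h4' (i - (k + 1))
      simp only [show i - 1 - (i - (k + 1)) = k by omega, show i - (k + 1) + 1 = i - k by omega,
        show i - (k + 1) < i by omega, if_true] at this
      simp [this hk, show ¬ i ≤ k by omega, show ¬ i ≤ k + 1 by omega]
    · subst hik
      have := h4' 0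
      simp at this
      simp [← this hk, hY, hY']
    · have := h4 (k - i)
      simp only [show i + (k - i) = k by omega, show k - i + 1 = k + 1 - i by omega] at this
      simp [this hk, show i ≤ k by omega, show i ≤ k + 1 by omega]

lemma ladderGraph_adj {n : ℕ} {u v : Fin 2 × Fin n} :
    (ladderGraph n).Adj u v ↔ u.1 ≠ v.1 ∧ u.2 = v.2 ∨
      u.1 = v.1 ∧ (u.2.val + 1 = v.2.val ∨ v.2.val + 1 = u.2.val) := by
  rw [ladderGraph, SimpleGraph.boxProd_adj, SimpleGraph.pathGraph_adj, SimpleGraph.pathGraph_adj]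
  have : (u.1.val + 1 = v.1.val ∨ v.1.val + 1 = u.1.val) ↔ u.1 ≠ v.1 := by
    generalize u.1 = a, v.1 = b
    revert a b
    decide
  rw [this]
  tauto

/-- A selection of ladder edges: each column records its rung and the two horizontal edges
joining it to the next column. -/
abbrev LadderConfig (n : ℕ) : Type := Fin n → Bool × Bool × Bool

namespace LadderConfig

/-- No square has exactly three selected edges, and nothing is selected past the last column. -/
def IsFlat {m : ℕ} (s : LadderConfig (m + 1)) : Prop :=
  (∀ i : Fin m, SquareFlat (s i.castSucc).1 (s i.castSucc).2 (s i.succ).1) ∧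
    (s (Fin.last m)).2 = (false, false)

/-- The column `k` of `s`, with nothing selected when `k` is out of range. -/
def col {n : ℕ} (s : LadderConfig n) (k : ℕ) : Bool × Bool × Bool :=
  if h : k < n then s ⟨k, h⟩ else (false, false, false)

@[simp] lemma col_val {n : ℕ} (s : LadderConfig n) (i : Fin n) : s.col i = s i := by
  simp [col]

lemma IsFlat.squareFlat_col {m : ℕ} {s : LadderConfig (m + 1)} (hs : s.IsFlat) (k : ℕ) :
    SquareFlat (s.col k).1 (s.col k).2 (s.col (k + 1)).1 := by
  rcases lt_trichotomy k m with hk | rfl | hk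
  · simpa [col, hk, Nat.lt_succ_of_lt hk] using hs.1 ⟨k, hk⟩
  · have h1 : s.col k = s (Fin.last k) := s.col_val (Fin.last k)
    rw [h1, hs.2]
    have := (s (Fin.last k)).1.toNat_le
    simp [SquareFlat, col]
    omega
  · simp [col, SquareFlat, show ¬ k < m + 1 by omega, show ¬ k < m by omega]

/-- The horizontal edge in the given row of a column. -/
def hor (c : Bool × Bool × Bool) (a : Fin 2) : Bool := if a = 0 then c.2.1 else c.2.2

/-- The spanning subgraph of the ladder formed by the selected edges. -/
def graph {n : ℕ} (s : LadderConfig n) : SimpleGraph (Fin 2 × Fin n) where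
  Adj u v := u.1 ≠ v.1 ∧ u.2 = v.2 ∧ (s u.2).1 = true ∨
    u.1 = v.1 ∧ (u.2.val + 1 = v.2.val ∧ hor (s u.2) u.1 = true ∨
      v.2.val + 1 = u.2.val ∧ hor (s v.2) u.1 = true)
  symm := ⟨by
    rintro ⟨a, i⟩ ⟨b, j⟩ (⟨h, rfl, h'⟩ | ⟨rfl, h⟩)
    · exact Or.inl ⟨h.symm, rfl, h'⟩
    · exact Or.inr ⟨rfl, h.symm⟩⟩
  loopless := ⟨by simp⟩

lemma graph_adj {n : ℕ} {s : LadderConfig n} {u v : Fin 2 × Fin n} :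
    s.graph.Adj u v ↔ u.1 ≠ v.1 ∧ u.2 = v.2 ∧ (s u.2).1 = true ∨
    u.1 = v.1 ∧ (u.2.val + 1 = v.2.val ∧ hor (s u.2) u.1 = true ∨
      v.2.val + 1 = u.2.val ∧ hor (s v.2) u.1 = true) := Iff.rfl

lemma graph_le {n : ℕ} (s : LadderConfig n) : s.graph ≤ ladderGraph n := by
  intro u v h
  rw [ladderGraph_adj]
  rw [graph_adj] at h
  tauto

/-- A two-colouring of the columns which respects the selected edges is constant on
connected components. -/
lemma colour_eq_of_reachable {n : ℕ} {s : LadderConfig n} {X Y : ℕ → Bool}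
    (h1 : ∀ k, (s.col k).1 = true → X k = Y k) (h2 : ∀ k, (s.col k).2.1 = true → X k = X (k + 1))
    (h3 : ∀ k, (s.col k).2.2 = true → Y k = Y (k + 1)) {u v : Fin 2 × Fin n}
    (h : s.graph.Reachable u v) :
    (if u.1 = 0 then X u.2 else Y u.2) = if v.1 = 0 then X v.2 else Y v.2 := by
  refine h.eq_of_adj_imp_eq (f := fun u : Fin 2 × Fin n ↦ if u.1 = 0 then X u.2 else Y u.2) ?_
  have hor_imp : ∀ (a : Fin 2) (i j : Fin n), i.val + 1 = j.val → hor (s i) a = true →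
      (if a = 0 then X i else Y i) = if a = 0 then X j else Y j := by
    intro a i j hij ha
    have h2 := h2 i
    have h3 := h3 i
    rw [col_val, hij] at h2 h3
    unfold hor at ha
    split_ifs at ha ⊢ <;> tauto
  rintro ⟨a, i⟩ ⟨b, j⟩ (⟨hab, hij, hr⟩ | ⟨hab, ⟨hij, hh⟩ | ⟨hij, hh⟩⟩) <;> dsimp only at *
  · subst hij
    have := h1 i (by rwa [col_val])
    split_ifs <;> simp [this]
  · subst hab
    exact hor_imp a i j hij hh
  · subst hab
    exact (hor_imp a j i hij hh).symm

lemma IsFlat.hor_of_reachable {m : ℕ} {s : LadderConfig (m + 1)} (hs : s.IsFlat) {a : Fin 2}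
    {i j : Fin (m + 1)} (hij : i.val + 1 = j.val) (h : s.graph.Reachable (a, i) (a, j)) :
    hor (s i) a = true := by
  by_contra ha
  by_cases he : (s i).2.1 = (s i).2.2
  · have hf : (s i).2.1 = false ∧ (s i).2.2 = false := by
      unfold hor at ha
      split_ifs at ha <;> simp_all
    let X : ℕ → Bool := fun k ↦ decide (k ≤ i)
    have hX : ∀ k, (s.col k).2.1 = true ∨ (s.col k).2.2 = true → X k = X (k + 1) := by
      intro k hk
      have : k ≠ i := by
        rintro rfl
        simp [hf] at hk
      simp only [X, decide_eq_decide]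
      omega
    have := colour_eq_of_reachable (fun _ _ ↦ rfl) (fun k hk ↦ hX k (Or.inl hk))
      (fun k hk ↦ hX k (Or.inr hk)) h
    simp [X, ← hij] at this
  · have hsq := hs.squareFlat_col i
    rw [hij, col_val, col_val] at hsq
    have hr : (s i).1 = false ∨ (s j).1 = false := by
      revert hsq he
      generalize s i = x, s j = y
      revert x y
      decide
    rcases hr with hr | hr
    · obtain ⟨X, Y, hX, hY, h1, -, h2, h3, h4⟩ := exists_cut (r := fun k ↦ (s.col k).1)
        (h := fun k ↦ (s.col k).2) hs.squareFlat_col (i := i) (by simpa using hr)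
      have := colour_eq_of_reachable h2 h3 h4 h
      have h1 := h1 (by simpa using he)
      have h3 := h3 i
      have h4 := h4 i
      rw [hij] at h1 h3 h4
      simp only [col_val] at h3 h4
      unfold hor at ha
      split_ifs at ha this <;> simp_all
    · obtain ⟨X, Y, hX, hY, -, h1, h2, h3, h4⟩ := exists_cut (r := fun k ↦ (s.col k).1)
        (h := fun k ↦ (s.col k).2) hs.squareFlat_col (i := j) (by simpa using hr)
      have := colour_eq_of_reachable h2 h3 h4 h
      have h1 := h1 i hij (by simpa using he)
      have h3 := h3 i
      have h4 := h4 i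
      rw [hij] at h3 h4
      simp only [col_val] at h3 h4
      unfold hor at ha
      split_ifs at ha this <;> simp_all

lemma IsFlat.rung_of_reachable {m : ℕ} {s : LadderConfig (m + 1)} (hs : s.IsFlat) {a b : Fin 2}
    (hab : a ≠ b) {i : Fin (m + 1)} (h : s.graph.Reachable (a, i) (b, i)) : (s i).1 = true := by
  by_contra hr
  obtain ⟨X, Y, hX, hY, -, -, h2, h3, h4⟩ := exists_cut (r := fun k ↦ (s.col k).1)
    (h := fun k ↦ (s.col k).2) hs.squareFlat_col (i := i) (by simpa using hr)
  have := colour_eq_of_reachable h2 h3 h4 h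
  simp only [hX, hY] at this
  split_ifs at this <;> omega

lemma IsFlat.graph_isFlat {m : ℕ} {s : LadderConfig (m + 1)} (hs : s.IsFlat) :
    (ladderGraph (m + 1)).IsFlat s.graph := by
  refine ⟨s.graph_le, ?_⟩
  rintro ⟨a, i⟩ ⟨b, j⟩ hadj hr
  rw [ladderGraph_adj] at hadj
  rw [graph_adj]
  rcases hadj with ⟨hab, hij⟩ | ⟨hab, hij | hij⟩ <;> dsimp only at *
  · subst hij
    exact Or.inl ⟨hab, rfl, hs.rung_of_reachable hab hr⟩
  · subst hab
    exact Or.inr ⟨rfl, Or.inl ⟨hij, hs.hor_of_reachable hij hr⟩⟩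
  · subst hab
    exact Or.inr ⟨rfl, Or.inr ⟨hij, hs.hor_of_reachable hij hr.symm⟩⟩

lemma graph_adj_rung {n : ℕ} {s : LadderConfig n} {i : Fin n} :
    s.graph.Adj (0, i) (1, i) ↔ (s i).1 = true := by
  simp [graph_adj]

lemma graph_adj_hor {n : ℕ} {s : LadderConfig n} {a : Fin 2} {i j : Fin n}
    (hij : i.val + 1 = j.val) : s.graph.Adj (a, i) (a, j) ↔ hor (s i) a = true := by
  simp only [graph_adj]
  simp [hij, show ¬ j.val + 1 = i.val by omega]

lemma IsFlat.eq_of_graph_eq {m : ℕ} {s t : LadderConfig (m + 1)} (hs : s.IsFlat) (ht : t.IsFlat)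
    (h : s.graph = t.graph) : s = t := by
  funext i
  have h1 : (s i).1 = (t i).1 := by
    rw [Bool.eq_iff_iff, ← graph_adj_rung, h, graph_adj_rung]
  refine Prod.ext h1 ?_
  induction i using Fin.lastCases with
  | last => rw [hs.2, ht.2]
  | cast i =>
    have key : ∀ a, hor (s i.castSucc) a = hor (t i.castSucc) a := fun a ↦ by
      rw [Bool.eq_iff_iff, ← graph_adj_hor (j := i.succ) (by simp), h, graph_adj_hor (by simp)]
    exact Prod.ext (by simpa [hor] using key 0) (by simpa [hor] using key 1)

open Classical in
/-- The edges of `H` on the ladder, read column by column. -/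
noncomputable def ofGraph {n : ℕ} (H : SimpleGraph (Fin 2 × Fin n)) : LadderConfig n := fun i ↦
  (decide (H.Adj (0, i) (1, i)), decide (∃ j : Fin n, i.val + 1 = j.val ∧ H.Adj (0, i) (0, j)),
    decide (∃ j : Fin n, i.val + 1 = j.val ∧ H.Adj (1, i) (1, j)))

lemma hor_ofGraph {n : ℕ} {H : SimpleGraph (Fin 2 × Fin n)} {a : Fin 2} {i j : Fin n}
    (hij : i.val + 1 = j.val) : hor (ofGraph H i) a = true ↔ H.Adj (a, i) (a, j) := by
  have : ∀ a, (∃ j : Fin n, i.val + 1 = j.val ∧ H.Adj (a, i) (a, j)) ↔ H.Adj (a, i) (a, j) := by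
    refine fun a ↦ ⟨?_, fun h ↦ ⟨j, hij, h⟩⟩
    rintro ⟨k, hk, h⟩
    rwa [show j = k from Fin.ext (by omega)]
  fin_cases a <;> simp [hor, ofGraph, this]

lemma graph_ofGraph {n : ℕ} {H : SimpleGraph (Fin 2 × Fin n)} (hH : H ≤ ladderGraph n) :
    (ofGraph H).graph = H := by
  have rung : ∀ {a b : Fin 2} {i : Fin n}, a ≠ b →
      ((ofGraph H i).1 = true ↔ H.Adj (a, i) (b, i)) := by
    intro a b i hab
    fin_cases a <;> fin_cases b <;> simp [ofGraph, H.adj_comm] at *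
  ext ⟨a, i⟩ ⟨b, j⟩
  rw [graph_adj]
  dsimp only
  constructor
  · rintro (⟨hab, rfl, h⟩ | ⟨rfl, ⟨hij, h⟩ | ⟨hij, h⟩⟩)
    · exact (rung hab).1 h
    · exact (hor_ofGraph hij).1 h
    · exact ((hor_ofGraph hij).1 h).symm
  · intro h
    have hadj := hH h
    rw [ladderGraph_adj] at hadj
    rcases hadj with ⟨hab, hij⟩ | ⟨hab, hij | hij⟩ <;> dsimp only at *
    · subst hij
      exact Or.inl ⟨hab, rfl, (rung hab).2 h⟩
    · subst hab
      exact Or.inr ⟨rfl, Or.inl ⟨hij, (hor_ofGraph hij).2 h⟩⟩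
    · subst hab
      exact Or.inr ⟨rfl, Or.inr ⟨hij, (hor_ofGraph hij).2 h.symm⟩⟩

lemma isFlat_ofGraph {m : ℕ} {H : SimpleGraph (Fin 2 × Fin (m + 1))}
    (hH : (ladderGraph (m + 1)).IsFlat H) : (ofGraph H).IsFlat := by
  obtain ⟨hle, hcl⟩ := hH
  constructor
  · intro i
    have hij : i.castSucc.val + 1 = i.succ.val := by simp
    have h0 := hor_ofGraph (H := H) (a := 0) hij
    have h1 := hor_ofGraph (H := H) (a := 1) hij
    have hr : (ofGraph H i.castSucc).1 = true ↔ H.Adj (0, i.castSucc) (1, i.castSucc) := by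
      simp [ofGraph]
    have hr' : (ofGraph H i.succ).1 = true ↔ H.Adj (0, i.succ) (1, i.succ) := by
      simp [ofGraph]
    simp only [hor] at h0 h1
    have c0 := hcl (0, i.castSucc) (0, i.succ) (ladderGraph_adj.2 (by simp))
    have c1 := hcl (1, i.castSucc) (1, i.succ) (ladderGraph_adj.2 (by simp))
    have c := hcl (0, i.castSucc) (1, i.castSucc) (ladderGraph_adj.2 (by simp))
    have c' := hcl (0, i.succ) (1, i.succ) (ladderGraph_adj.2 (by simp))
    have d0 : H.Adj (0, i.castSucc) (1, i.castSucc) → H.Adj (1, i.castSucc) (1, i.succ) →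
        H.Adj (0, i.succ) (1, i.succ) → H.Adj (0, i.castSucc) (0, i.succ) := fun x y z ↦
      c0 ((x.reachable.trans y.reachable).trans z.reachable.symm)
    have d1 : H.Adj (0, i.castSucc) (1, i.castSucc) → H.Adj (0, i.castSucc) (0, i.succ) →
        H.Adj (0, i.succ) (1, i.succ) → H.Adj (1, i.castSucc) (1, i.succ) := fun x y z ↦
      c1 ((x.reachable.symm.trans y.reachable).trans z.reachable)
    have d : H.Adj (0, i.castSucc) (0, i.succ) → H.Adj (0, i.succ) (1, i.succ) →
        H.Adj (1, i.castSucc) (1, i.succ) → H.Adj (0, i.castSucc) (1, i.castSucc) := fun x y z ↦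
      c ((x.reachable.trans y.reachable).trans z.reachable.symm)
    have d' : H.Adj (0, i.castSucc) (0, i.succ) → H.Adj (0, i.castSucc) (1, i.castSucc) →
        H.Adj (1, i.castSucc) (1, i.succ) → H.Adj (0, i.succ) (1, i.succ) := fun x y z ↦
      c' ((x.reachable.symm.trans y.reachable).trans z.reachable)
    rw [← h0, ← h1, ← hr, ← hr'] at d0 d1 d d'
    revert d0 d1 d d'
    generalize ofGraph H i.castSucc = x, ofGraph H i.succ = y
    revert x y
    decide
  · have : ∀ j : Fin (m + 1), m + 1 ≠ j.val := fun j ↦ by omega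
    simp [ofGraph, this]

/-- The number of flat configurations on `m + 1` columns whose first rung is `c`. -/
noncomputable def count (m : ℕ) (c : Bool) : ℕ :=
  Nat.card {s : LadderConfig (m + 1) // s.IsFlat ∧ (s 0).1 = c}

lemma count_zero (c : Bool) : count 0 c = 1 := by
  rw [count, Nat.card_eq_one_iff_unique]
  constructor
  · constructor
    rintro ⟨s, ⟨-, h⟩, h'⟩ ⟨t, ⟨-, k⟩, k'⟩
    refine Subtype.ext (funext fun i ↦ ?_)
    obtain rfl : i = Fin.last 0 := Fin.ext (by omega)
    exact Prod.ext (h'.trans k'.symm) (h.trans k.symm)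
  · exact ⟨⟨fun _ ↦ (c, false, false), ⟨fun i ↦ i.elim0, rfl⟩, rfl⟩⟩

lemma isFlat_cons {m : ℕ} {x : Bool × Bool × Bool} {s : LadderConfig (m + 1)} :
    IsFlat (Fin.cons x s : LadderConfig (m + 2)) ↔ SquareFlat x.1 x.2 (s 0).1 ∧ s.IsFlat := by
  simp only [IsFlat, Fin.forall_fin_succ (n := m), ← Fin.succ_last, Fin.cons_succ,
    Fin.castSucc_zero, Fin.cons_zero, ← Fin.succ_castSucc, and_assoc]

/-- Splitting off the first column of a flat configuration. -/
def consEquiv (m : ℕ) (c : Bool) :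
    {s : LadderConfig (m + 2) // s.IsFlat ∧ (s 0).1 = c} ≃
      Σ c' : Bool, {h : Bool × Bool // SquareFlat c h c'} ×
        {s : LadderConfig (m + 1) // s.IsFlat ∧ (s 0).1 = c'} where
  toFun s :=
    have hs : SquareFlat (s.1 0).1 (s.1 0).2 (s.1 1).1 ∧ IsFlat (Fin.tail s.1) :=
      isFlat_cons.1 (by rw [Fin.cons_self_tail]; exact s.2.1)
    ⟨(s.1 1).1, ⟨(s.1 0).2, by simpa only [s.2.2] using hs.1⟩, ⟨Fin.tail s.1, hs.2, rfl⟩⟩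
  invFun p := ⟨Fin.cons (c, p.2.1.1) p.2.2.1,
    isFlat_cons.2 ⟨by rw [p.2.2.2.2]; exact p.2.1.2, p.2.2.2.1⟩, rfl⟩
  left_inv := by
    rintro ⟨s, hs, rfl⟩
    exact Subtype.ext (Fin.cons_self_tail s)
  right_inv := by
    rintro ⟨_, ⟨h, hh⟩, ⟨s, hs, rfl⟩⟩
    rfl

lemma count_succ (m : ℕ) (c : Bool) :
    count (m + 1) c =
      ∑ c' : Bool, Fintype.card {h : Bool × Bool // SquareFlat c h c'} * count m c' := by
  rw [count, Nat.card_congr (consEquiv m c), Nat.card_sigma]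
  simp only [Nat.card_prod, Nat.card_eq_fintype_card (α := {h : Bool × Bool // SquareFlat c h _}),
    count]

lemma count_succ_false (m : ℕ) :
    count (m + 1) false = 3 * count m true + 4 * count m false := by
  rw [count_succ, Fintype.sum_bool]
  rfl

lemma count_succ_true (m : ℕ) :
    count (m + 1) true = 2 * count m true + 3 * count m false := by
  rw [count_succ, Fintype.sum_bool]
  rfl

end LadderConfig

open LadderConfig in
lemma numComp_ladderGraph_succ (m : ℕ) :
    numComp (ladderGraph (m + 1)) = count m true + count m false := by
  let e : {H // (ladderGraph (m + 1)).IsFlat H} ≃ {s : LadderConfig (m + 1) // s.IsFlat} :=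
    { toFun H := ⟨ofGraph H.1, isFlat_ofGraph H.2⟩
      invFun s := ⟨s.1.graph, s.2.graph_isFlat⟩
      left_inv H := Subtype.ext (graph_ofGraph H.2.1)
      right_inv s := Subtype.ext ((isFlat_ofGraph s.2.graph_isFlat).eq_of_graph_eq s.2
        (graph_ofGraph s.1.graph_le)) }
  let f : {s : LadderConfig (m + 1) // s.IsFlat} → Bool := fun s ↦ (s.1 0).1
  rw [numComp_eq_card_isFlat, Nat.card_congr e, Nat.card_congr (Equiv.sigmaFiberEquiv f).symm,
    Nat.card_sigma, Fintype.sum_bool]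
  have hf : ∀ c, Nat.card {s // f s = c} = count m c := fun c ↦
    Nat.card_congr (Equiv.subtypeSubtypeEquivSubtypeInter IsFlat
      fun s : LadderConfig (m + 1) ↦ (s 0).1 = c)
  rw [hf, hf]

/-- `C(L_1) = 2`, `C(L_2) = 12`, and for `n > 2`,
`C(L_n) = 6·C(L_{n−1}) + C(L_{n−2})`. -/
theorem numComp_ladderGraph :
    numComp (ladderGraph 1) = 2 ∧ numComp (ladderGraph 2) = 12 ∧
      ∀ n : ℕ, 2 < n →
        numComp (ladderGraph n) =
          6 * numComp (ladderGraph (n - 1)) + numComp (ladderGraph (n - 2)) := by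
  refine ⟨?_, ?_, fun n hn ↦ ?_⟩
  · simp [numComp_ladderGraph_succ, LadderConfig.count_zero]
  · simp [numComp_ladderGraph_succ 1, LadderConfig.count_zero, LadderConfig.count_succ_true,
      LadderConfig.count_succ_false]
  · obtain ⟨m, rfl⟩ : ∃ m, n = m + 3 := ⟨n - 3, by omega⟩
    change numComp (ladderGraph (m + 1 + 1 + 1)) =
      6 * numComp (ladderGraph (m + 1 + 1)) + numComp (ladderGraph (m + 1))
    simp only [numComp_ladderGraph_succ, LadderConfig.count_succ_true,
      LadderConfig.count_succ_false]
    ring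
end
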